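/- Let G be a connected simple graph with m edges, m ≥ 3, such that every vertex of degree at least three is a support vertex. Then G is antimagic, i.e., there exists a bijection φ from the edge set of G to {1, 2, ..., m} such that the induced vertex sums φ₊(u) = Σ_{uv ∈ E} φ(uv) are pairwise distinct. -/

import Mathlib

open scoped Classical

noncomputable def edgeFS {V : Type*} [Fintype V] (G : SimpleGraph V) : Finset (Sym2 V) :=
  G.edgeSet.toFinset

noncomputable def vSum {V : Type*} [Fintype V] (G : SimpleGraph V) (φ : Sym2 V → ℝ) (v : V) : ℝ :=
  ∑ e ∈ (edgeFS G).filter (fun e => v ∈ e), φ e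

noncomputable def vProd {V : Type*} [Fintype V] (G : SimpleGraph V) (φ : Sym2 V → ℝ) (v : V) : ℝ :=
  ∏ e ∈ (edgeFS G).filter (fun e => v ∈ e), φ e

/-- Greedy labelling. Each `u ∈ Λ` has a single unlabelled element `cu u`, each `v ∈ T` has a
private unlabelled element `f v` and the shared ones in `X v ∩ U`; labels are used in increasing
order and every vertex sum that is completed exceeds all the previously completed ones. -/
theorem exists_greedy_labelling {α β : Type*} [Fintype β] (Λ : Set β) (cu : β → α)
    (d : β → ℕ) (κ : α → ℕ) (f : β → α) (X : β → Finset α) (B : ℕ)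
    (hmono : ∀ u ∈ Λ, ∀ u' ∈ Λ, κ (cu u) < κ (cu u') → d u ≤ d u')
    (hpair : ∀ u ∈ Λ, ∀ u' ∈ Λ, u ≠ u' → cu u = cu u' → d u ≠ d u' ∧ d u ≤ d u' + 1)
    (n : ℕ) : ∀ (U : Finset α) (T : Finset β) (c M : ℕ) (R : β → ℕ), U.card + T.card = n →
      Set.InjOn κ U → (∀ e ∈ U, ∃ u ∈ Λ, cu u = e) → Set.InjOn f T → (∀ v ∈ T, f v ∉ U) →
      (∀ v ∈ T, v ∉ Λ) →
      (∀ v ∈ T, X v ∩ U = ∅ → M < R v + c + 1) →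
      (∀ u ∈ Λ, cu u ∈ U → M < d u + c + 1) →
      (∀ v ∈ T, B ≤ R v) →
      (∀ v ∈ T, ∀ u ∈ Λ, cu u ∈ X v → cu u ∈ U →
        d u ≤ B + c + (U.filter (fun e => κ e ≤ κ (cu u))).card) →
      (∀ v ∈ T, ∀ u ∈ Λ, ∀ u' ∈ Λ, cu u ∈ X v → cu u' = cu u → u' = u) →
      ∃ ψ : α → ℕ, Set.BijOn ψ ↑(U ∪ T.image f) ↑(Finset.Ioc c (c + n)) ∧
        ∃ s : β → ℕ, (∀ u ∈ Λ, cu u ∈ U → s u = d u + ψ (cu u)) ∧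
          (∀ v ∈ T, s v = R v + ∑ e ∈ X v ∩ U, ψ e + ψ (f v)) ∧
          (∀ w, (w ∈ T ∨ w ∈ Λ ∧ cu w ∈ U) → M < s w) ∧
          (∀ w w', (w ∈ T ∨ w ∈ Λ ∧ cu w ∈ U) → (w' ∈ T ∨ w' ∈ Λ ∧ cu w' ∈ U) →
            s w = s w' → w = w') := by
  induction n with
  | zero =>
    intro U T c M R hn hκ hU hf hfU hTΛ h1 h2 h3 h4 h5
    have hU0 : U = ∅ := by rw [← Finset.card_eq_zero]; omega
    have hT0 : T = ∅ := by rw [← Finset.card_eq_zero]; omega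
    subst hU0 hT0
    exact ⟨fun _ => 0, by simp, fun _ => 0, by simp, by simp, by simp, by simp⟩
  | succ n ih =>
    intro U T c M R hn hκ hU hf hfU hTΛ h1 h2 h3 h4 h5
    by_cases hA : ∃ v ∈ T, X v ∩ U = ∅ ∧ ∀ u ∈ Λ, cu u ∈ U → R v ≤ d u
    · obtain ⟨v, hvT, ⟨hvX, hvd⟩, hvmin⟩ : ∃ v ∈ T,
          (X v ∩ U = ∅ ∧ ∀ u ∈ Λ, cu u ∈ U → R v ≤ d u) ∧
          ∀ v' ∈ T, (X v' ∩ U = ∅ ∧ ∀ u ∈ Λ, cu u ∈ U → R v' ≤ d u) → R v ≤ R v' := by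
        obtain ⟨v0, hv0, hv0'⟩ := hA
        obtain ⟨v, hv, hmin⟩ := Finset.exists_min_image
          (T.filter (fun v => X v ∩ U = ∅ ∧ ∀ u ∈ Λ, cu u ∈ U → R v ≤ d u)) R
          ⟨v0, Finset.mem_filter.2 ⟨hv0, hv0'⟩⟩
        rw [Finset.mem_filter] at hv
        exact ⟨v, hv.1, hv.2, fun v' h h' => hmin v' (Finset.mem_filter.2 ⟨h, h'⟩)⟩
      have hvmin' : ∀ v' ∈ T, X v' ∩ U = ∅ → R v ≤ R v' := by
        intro v' hv' hX
        by_cases h : ∀ u ∈ Λ, cu u ∈ U → R v' ≤ d u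
        · exact hvmin v' hv' ⟨hX, h⟩
        · push Not at h
          obtain ⟨u, hu, huU, hlt⟩ := h
          exact (hvd u hu huU).trans hlt.le
      have hTc : (T.erase v).card + 1 = T.card := Finset.card_erase_add_one hvT
      obtain ⟨ψ, hψ, s, hs1, hs2, hs3, hs4⟩ := ih U (T.erase v) (c + 1) (R v + c + 1) R
        (by omega) hκ hU (hf.mono (by simp))
        (fun w hw => hfU w (Finset.mem_of_mem_erase hw))
        (fun w hw => hTΛ w (Finset.mem_of_mem_erase hw))
        (fun w hw hX => by have := hvmin' w (Finset.mem_of_mem_erase hw) hX; omega)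
        (fun u hu huU => by have := hvd u hu huU; omega)
        (fun w hw => h3 w (Finset.mem_of_mem_erase hw))
        (fun w hw u hu h h' => by
          have := h4 w (Finset.mem_of_mem_erase hw) u hu h h'; omega)
        (fun w hw => h5 w (Finset.mem_of_mem_erase hw))
      have hne : ∀ e ∈ U, e ≠ f v := fun e he h => hfU v hvT (h ▸ he)
      have hne' : ∀ w ∈ T.erase v, f w ≠ f v := fun w hw h =>
        Finset.ne_of_mem_erase hw (hf (Finset.mem_of_mem_erase hw) hvT h)
      have hopen : ∀ w, (w ∈ T ∨ w ∈ Λ ∧ cu w ∈ U) → w ≠ v →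
          (w ∈ T.erase v ∨ w ∈ Λ ∧ cu w ∈ U) := by
        rintro w (h | h) hw
        · exact Or.inl (Finset.mem_erase.2 ⟨hw, h⟩)
        · exact Or.inr h
      have hM : M < R v + c + 1 := h1 v hvT hvX
      refine ⟨Function.update ψ (f v) (c + 1), ?_, Function.update s v (R v + c + 1),
        ?_, ?_, ?_, ?_⟩
      · have e1 : ((U ∪ T.image f : Finset α) : Set α) =
            insert (f v) ↑(U ∪ (T.erase v).image f) := by
          ext e
          simp only [Finset.coe_union, Finset.coe_image, Set.mem_union, Finset.mem_coe,
            Set.mem_image, Set.mem_insert_iff, Finset.mem_erase]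
          constructor
          · rintro (h | ⟨w, hw, rfl⟩)
            · exact Or.inr (Or.inl h)
            · by_cases h : w = v
              · exact Or.inl (by rw [h])
              · exact Or.inr (Or.inr ⟨w, ⟨h, hw⟩, rfl⟩)
          · rintro (rfl | h | ⟨w, ⟨_, hw⟩, rfl⟩)
            · exact Or.inr ⟨v, hvT, rfl⟩
            · exact Or.inl h
            · exact Or.inr ⟨w, hw, rfl⟩
        have e2 : ((Finset.Ioc c (c + (n + 1)) : Finset ℕ) : Set ℕ) =
            insert (c + 1) ↑(Finset.Ioc (c + 1) (c + 1 + n)) := by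
          ext x; simp; omega
        rw [e1, e2]
        have hb : Set.BijOn (Function.update ψ (f v) (c + 1)) ↑(U ∪ (T.erase v).image f)
            ↑(Finset.Ioc (c + 1) (c + 1 + n)) := by
          refine hψ.congr ?_
          intro e he
          have : e ≠ f v := by
            simp only [Finset.coe_union, Finset.coe_image, Set.mem_union, Finset.mem_coe,
              Set.mem_image] at he
            rcases he with he | ⟨w, hw, rfl⟩
            · exact hne e he
            · exact hne' w hw
          rw [Function.update_of_ne this]
        have := hb.insert (a := f v) (by simp)
        simpa using this
      · intro u hu huU
        have : u ≠ v := fun h => hTΛ v hvT (h ▸ hu)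
        rw [Function.update_of_ne this, Function.update_of_ne (hne _ huU), hs1 u hu huU]
      · intro w hw
        by_cases h : w = v
        · subst h; simp [hvX, add_assoc]
        · have hw' := Finset.mem_erase.2 ⟨h, hw⟩
          rw [Function.update_of_ne h, Function.update_of_ne (hne' w hw'), hs2 w hw']
          congr 2
          refine Finset.sum_congr rfl fun e he => ?_
          rw [Function.update_of_ne (hne e (Finset.mem_inter.1 he).2)]
      · intro w hw
        by_cases h : w = v
        · subst h; simpa using hM
        · rw [Function.update_of_ne h]
          exact hM.trans (hs3 w (hopen w hw h))
      · intro w w' hw hw' heq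
        by_cases h : w = v <;> by_cases h' : w' = v
        · rw [h, h']
        · rw [h, Function.update_self, Function.update_of_ne h'] at heq
          have := hs3 w' (hopen w' hw' h'); omega
        · rw [h', Function.update_self, Function.update_of_ne h] at heq
          have := hs3 w (hopen w hw h); omega
        · rw [Function.update_of_ne h, Function.update_of_ne h'] at heq
          exact hs4 w w' (hopen w hw h) (hopen w' hw' h') heq
    · push Not at hA
      have hUne : U.Nonempty := by
        by_contra hU0
        rw [Finset.not_nonempty_iff_eq_empty] at hU0
        subst hU0
        have : T.Nonempty := by rw [← Finset.card_pos]; simp at hn; omega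
        obtain ⟨v, hv⟩ := this
        obtain ⟨u, _, hu, _⟩ := hA v hv (by simp)
        simp at hu
      obtain ⟨e, heU, hemin⟩ := Finset.exists_min_image U κ hUne
      obtain ⟨u0, hu0, hu0e⟩ := hU e heU
      obtain ⟨um, hum, hmax⟩ := Finset.exists_max_image
        (Finset.univ.filter (fun u => u ∈ Λ ∧ cu u = e)) d ⟨u0, by simp [hu0, hu0e]⟩
      simp only [Finset.mem_filter, Finset.mem_univ, true_and] at hum hmax
      obtain ⟨humΛ, hume⟩ := hum
      have hlt : ∀ e' ∈ U.erase e, κ e < κ e' := fun e' he' =>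
        lt_of_le_of_ne (hemin e' (Finset.mem_of_mem_erase he')) fun h =>
          Finset.ne_of_mem_erase he' (hκ heU (Finset.mem_of_mem_erase he') h).symm
      have hdle : ∀ u ∈ Λ, cu u ∈ U.erase e → d um ≤ d u := fun u hu huU =>
        hmono um humΛ u hu (by rw [hume]; exact hlt _ huU)
      have hRd : ∀ v ∈ T, X v ∩ U = ∅ → d um ≤ R v := by
        intro v hv hX
        obtain ⟨u, hu, huU, hul⟩ := hA v hv hX
        by_cases h : cu u = e
        · by_cases h' : um = u
          · rw [h']; exact hul.le
          · have := (hpair um humΛ u hu h' (hume.trans h.symm)).2; omega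
        · exact (hdle u hu (Finset.mem_erase.2 ⟨h, huU⟩)).trans hul.le
      have hUc : (U.erase e).card + 1 = U.card := Finset.card_erase_add_one heU
      set R' : β → ℕ := fun w => if e ∈ X w then R w + (c + 1) else R w with hR'
      have hRR' : ∀ w, R w ≤ R' w := fun w => by simp only [hR']; split_ifs <;> omega
      have hfe : ∀ v ∈ T, f v ≠ e := fun v hv h => hfU v hv (h ▸ heU)
      obtain ⟨ψ, hψ, s, hs1, hs2, hs3, hs4⟩ := ih (U.erase e) T (c + 1) (d um + c + 1) R'
        (by omega) (hκ.mono (by simp))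
        (fun e' he' => hU e' (Finset.mem_of_mem_erase he')) hf
        (fun v hv h => hfU v hv (Finset.mem_of_mem_erase h)) hTΛ
        (by
          intro v hv hX
          by_cases hev : e ∈ X v
          · have hc : (U.filter (fun e' => κ e' ≤ κ e)).card = 1 := by
              rw [Finset.card_eq_one]
              refine ⟨e, ?_⟩
              ext e'
              simp only [Finset.mem_filter, Finset.mem_singleton]
              constructor
              · rintro ⟨h, h'⟩
                exact hκ h heU (le_antisymm h' (hemin e' h))
              · rintro rfl; exact ⟨heU, le_rfl⟩
            have := h4 v hv um humΛ (by rwa [hume]) (by rwa [hume])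
            rw [hume, hc] at this
            have := h3 v hv
            simp only [hR', if_pos hev]; omega
          · have : X v ∩ U = ∅ := by
              rw [← hX]; ext e'
              simp only [Finset.mem_inter, Finset.mem_erase]
              constructor
              · rintro ⟨h, h'⟩; exact ⟨h, fun hh => hev (hh ▸ h), h'⟩
              · rintro ⟨h, _, h'⟩; exact ⟨h, h'⟩
            have := hRd v hv this
            simp only [hR', if_neg hev]; omega)
        (fun u hu huU => by have := hdle u hu huU; omega)
        (fun v hv => (h3 v hv).trans (hRR' v))
        (by
          intro v hv u hu hX huU
          have := h4 v hv u hu hX (Finset.mem_of_mem_erase huU)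
          have h' : (U.filter (fun e' => κ e' ≤ κ (cu u))).card ≤
              ((U.erase e).filter (fun e' => κ e' ≤ κ (cu u))).card + 1 := by
            rw [Finset.filter_erase]
            have := Finset.pred_card_le_card_erase (a := e)
              (s := U.filter (fun e' => κ e' ≤ κ (cu u)))
            omega
          omega)
        h5
      have hM : ∀ u ∈ Λ, cu u = e → M < d u + c + 1 := fun u hu h => h2 u hu (h ▸ heU)
      have hopen : ∀ w, (w ∈ T ∨ w ∈ Λ ∧ cu w ∈ U) → ¬ (w ∈ Λ ∧ cu w = e) →
          (w ∈ T ∨ w ∈ Λ ∧ cu w ∈ U.erase e) := by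
        rintro w (h | h) hw
        · exact Or.inl h
        · exact Or.inr ⟨h.1, Finset.mem_erase.2 ⟨fun hh => hw ⟨h.1, hh⟩, h.2⟩⟩
      refine ⟨Function.update ψ e (c + 1), ?_,
        fun w => if w ∈ Λ ∧ cu w = e then d w + c + 1 else s w, ?_, ?_, ?_, ?_⟩
      · have e1 : ((U ∪ T.image f : Finset α) : Set α) =
            insert e ↑(U.erase e ∪ T.image f) := by
          rw [← Finset.coe_insert, ← Finset.insert_union, Finset.insert_erase heU]
        have e2 : ((Finset.Ioc c (c + (n + 1)) : Finset ℕ) : Set ℕ) =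
            insert (c + 1) ↑(Finset.Ioc (c + 1) (c + 1 + n)) := by
          ext x; simp; omega
        rw [e1, e2]
        have hb : Set.BijOn (Function.update ψ e (c + 1)) ↑(U.erase e ∪ T.image f)
            ↑(Finset.Ioc (c + 1) (c + 1 + n)) := by
          refine hψ.congr ?_
          intro e' he
          have : e' ≠ e := by
            simp only [Finset.coe_union, Finset.coe_image, Set.mem_union, Finset.mem_coe,
              Set.mem_image] at he
            rcases he with he | ⟨w, hw, rfl⟩
            · exact Finset.ne_of_mem_erase he
            · exact hfe w hw
          rw [Function.update_of_ne this]
        have := hb.insert (a := e) (by simp)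
        simpa using this
      · intro u hu huU
        by_cases h : cu u = e
        · simp [hu, h, add_assoc]
        · simp only [hu, h, and_false, if_false]
          rw [Function.update_of_ne h, hs1 u hu (Finset.mem_erase.2 ⟨h, huU⟩)]
      · intro v hv
        have hsum : ∑ e' ∈ X v ∩ U.erase e, Function.update ψ e (c + 1) e' =
            ∑ e' ∈ X v ∩ U.erase e, ψ e' := by
          refine Finset.sum_congr rfl fun e' he' => ?_
          rw [Function.update_of_ne (Finset.ne_of_mem_erase (Finset.mem_inter.1 he').2)]
        simp only [hTΛ v hv, false_and, if_false]
        rw [Function.update_of_ne (hfe v hv), hs2 v hv, ← hsum]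
        by_cases hev : e ∈ X v
        · have : X v ∩ U = insert e (X v ∩ U.erase e) := by
            ext e'
            simp only [Finset.mem_inter, Finset.mem_insert, Finset.mem_erase]
            constructor
            · rintro ⟨h, h'⟩
              by_cases hh : e' = e
              · exact Or.inl hh
              · exact Or.inr ⟨h, hh, h'⟩
            · rintro (rfl | ⟨h, _, h'⟩)
              · exact ⟨hev, heU⟩
              · exact ⟨h, h'⟩
          rw [this, Finset.sum_insert (by simp)]
          simp only [hR', if_pos hev, Function.update_self]; ring
        · have : X v ∩ U = X v ∩ U.erase e := by
            ext e'
            simp only [Finset.mem_inter, Finset.mem_erase]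
            constructor
            · rintro ⟨h, h'⟩; exact ⟨h, fun hh => hev (hh ▸ h), h'⟩
            · rintro ⟨h, _, h'⟩; exact ⟨h, h'⟩
          rw [this]
          simp only [hR', if_neg hev]
      · intro w hw
        by_cases h : w ∈ Λ ∧ cu w = e
        · simp only [h, and_self, if_true]; exact hM w h.1 h.2
        · simp only [h, if_false]
          have h' := hs3 w (hopen w hw h)
          have := hM um humΛ hume; omega
      · intro w w' hw hw' heq
        by_cases h : w ∈ Λ ∧ cu w = e <;> by_cases h' : w' ∈ Λ ∧ cu w' = e
        · simp only [h, h', and_self, if_true] at heq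
          by_contra hne
          exact (hpair w h.1 w' h'.1 hne (h.2.trans h'.2.symm)).1 (by omega)
        · simp only [h, h', and_self, if_true, if_false] at heq
          have := hs3 w' (hopen w' hw' h')
          have := hmax w h; omega
        · simp only [h, h', and_self, if_true, if_false] at heq
          have := hs3 w (hopen w hw h)
          have := hmax w' h'; omega
        · simp only [h, h', if_false] at heq
          have hw₂ := hopen w' hw' h'
          exact hs4 w w' (hopen w hw h) hw₂ heq

/-- The last step of a geodesic. -/
theorem exists_adj_dist_eq {α : Type*} {H : SimpleGraph α} {a x : α} (hr : H.Reachable a x)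
    (hx : H.dist a x ≠ 0) :
    ∃ y, H.Adj y x ∧ H.Reachable a y ∧ H.dist a y + 1 = H.dist a x := by
  obtain ⟨p, hp⟩ := hr.symm.exists_walk_length_eq_dist
  rw [SimpleGraph.dist_comm] at hp
  cases p with
  | nil => simp at hx
  | @cons _ y _ h q =>
    refine ⟨y, h.symm, q.reachable.symm, ?_⟩
    have h1 := SimpleGraph.dist_le q
    have h2 := hr.dist_triangle_left y
    have h3 := h.symm.diff_dist_adj (u := a)
    rw [SimpleGraph.dist_comm] at h1
    simp only [SimpleGraph.Walk.length_cons] at hp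
    omega

/-- In a graph of maximum degree two, vertices are determined by their distance to a vertex
of degree at most one. -/
theorem dist_injective_of_degree_le_two {α : Type*} {H : SimpleGraph α}
    (h2 : ∀ e g₁ g₂ g₃, H.Adj e g₁ → H.Adj e g₂ → H.Adj e g₃ → g₁ = g₂ ∨ g₁ = g₃ ∨ g₂ = g₃)
    {a : α} (h1 : ∀ g₁ g₂, H.Adj a g₁ → H.Adj a g₂ → g₁ = g₂) {x y : α}
    (hx : H.Reachable a x) (hy : H.Reachable a y) (hxy : H.dist a x = H.dist a y) : x = y := by
  obtain ⟨n, hn⟩ : ∃ n, H.dist a x = n := ⟨_, rfl⟩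
  induction n using Nat.strong_induction_on generalizing x y with
  | _ n ih =>
    by_cases h0 : n = 0
    · subst h0
      rw [← (hx.dist_eq_zero_iff).1 hn, ← (hy.dist_eq_zero_iff).1 (hxy ▸ hn)]
    obtain ⟨p, hpx, hap, hpd⟩ := exists_adj_dist_eq hx (by omega)
    obtain ⟨p', hpy, hap', hpd'⟩ := exists_adj_dist_eq hy (by omega)
    obtain rfl : p = p' := ih (n - 1) (by omega) hap hap' (by omega) (by omega)
    by_cases hp0 : H.dist a p = 0
    · obtain rfl := (hap.dist_eq_zero_iff).1 hp0
      exact h1 _ _ hpx hpy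
    · obtain ⟨z, hz, haz, hzd⟩ := exists_adj_dist_eq hap hp0
      rcases h2 p x y z hpx hpy hz.symm with h | h | h
      · exact h
      · subst h; omega
      · subst h; omega

/-- Every distance up to the distance of a reachable vertex is attained. -/
theorem exists_reachable_dist_eq {α : Type*} {H : SimpleGraph α} {a x : α} {n : ℕ}
    (hr : H.Reachable a x) (hn : n ≤ H.dist a x) : ∃ y, H.Reachable a y ∧ H.dist a y = n := by
  obtain ⟨k, hk⟩ := Nat.exists_eq_add_of_le hn
  induction k generalizing x with
  | zero => exact ⟨x, hr, by omega⟩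
  | succ k ih =>
    obtain ⟨y, _, hy, hyd⟩ := exists_adj_dist_eq hr (by omega)
    exact ih hy (by omega) (by omega)

theorem dist_succ_of_adj {α : Type*} {H : SimpleGraph α}
    (h2 : ∀ e g₁ g₂ g₃, H.Adj e g₁ → H.Adj e g₂ → H.Adj e g₃ → g₁ = g₂ ∨ g₁ = g₃ ∨ g₂ = g₃)
    {a : α} (h1 : ∀ g₁ g₂, H.Adj a g₁ → H.Adj a g₂ → g₁ = g₂) {x y : α}
    (hx : H.Reachable a x) (hxy : H.Adj x y) :
    H.dist a y = H.dist a x + 1 ∨ H.dist a x = H.dist a y + 1 := by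
  have hne : H.dist a x ≠ H.dist a y := fun h =>
    hxy.ne (dist_injective_of_degree_le_two h2 h1 hx (hx.trans hxy.reachable) h)
  have := hxy.diff_dist_adj (u := a)
  omega

/-- A vertex of degree at most one other than `a` is the farthest one from `a`. -/
theorem dist_le_of_degree_le_one {α : Type*} {H : SimpleGraph α}
    (h2 : ∀ e g₁ g₂ g₃, H.Adj e g₁ → H.Adj e g₂ → H.Adj e g₃ → g₁ = g₂ ∨ g₁ = g₃ ∨ g₂ = g₃)
    {a : α} (h1 : ∀ g₁ g₂, H.Adj a g₁ → H.Adj a g₂ → g₁ = g₂) {x y : α}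
    (hx : H.Reachable a x) (hy : H.Reachable a y) (hax : a ≠ x)
    (h1x : ∀ g₁ g₂, H.Adj x g₁ → H.Adj x g₂ → g₁ = g₂) : H.dist a y ≤ H.dist a x := by
  by_contra! hlt
  have hx0 := hx.pos_dist_of_ne hax
  obtain ⟨p, hp, hap, hpd⟩ := exists_adj_dist_eq hx hx0.ne'
  obtain ⟨q, hq, hqd⟩ := exists_reachable_dist_eq (n := H.dist a x + 1) hy hlt
  obtain ⟨x', hx', hax', hx'd⟩ := exists_adj_dist_eq hq (by omega)
  obtain rfl := dist_injective_of_degree_le_two h2 h1 hx hax' (by omega)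
  obtain rfl := h1x _ _ hp.symm hx'
  omega

/-- A component of a graph of maximum degree two has at most two vertices of degree
at most one. -/
theorem eq_or_eq_or_eq_of_degree_le_one {α : Type*} {H : SimpleGraph α}
    (h2 : ∀ e g₁ g₂ g₃, H.Adj e g₁ → H.Adj e g₂ → H.Adj e g₃ → g₁ = g₂ ∨ g₁ = g₃ ∨ g₂ = g₃)
    {a x y : α} (h1 : ∀ g₁ g₂, H.Adj a g₁ → H.Adj a g₂ → g₁ = g₂)
    (h1x : ∀ g₁ g₂, H.Adj x g₁ → H.Adj x g₂ → g₁ = g₂)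
    (h1y : ∀ g₁ g₂, H.Adj y g₁ → H.Adj y g₂ → g₁ = g₂)
    (hx : H.Reachable a x) (hy : H.Reachable a y) : a = x ∨ a = y ∨ x = y := by
  by_contra! h
  exact h.2.2 (dist_injective_of_degree_le_two h2 h1 hx hy (le_antisymm
    (dist_le_of_degree_le_one h2 h1 hy hx h.2.1 h1y)
    (dist_le_of_degree_le_one h2 h1 hx hy h.1 h1x)))

theorem Sym2.eq_or_eq_or_eq_of_mem {α : Type*} {e : Sym2 α} {x y z : α} (hx : x ∈ e) (hy : y ∈ e)
    (hz : z ∈ e) : x = y ∨ x = z ∨ y = z := by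
  induction e with
  | _ a b =>
    rw [Sym2.mem_iff] at hx hy hz
    grind

theorem Sym2.eq_of_two_common {α : Type*} {e g : Sym2 α} {x y : α} (hxy : x ≠ y) (hx : x ∈ e)
    (hy : y ∈ e) (hx' : x ∈ g) (hy' : y ∈ g) : e = g :=
  ((Sym2.mem_and_mem_iff hxy).1 ⟨hx, hy⟩).trans ((Sym2.mem_and_mem_iff hxy).1 ⟨hx', hy'⟩).symm

theorem Sym2.exists_mem_ne {α : Type*} {e : Sym2 α} {x : α} (he : ¬ e.IsDiag) (hx : x ∈ e) :
    ∃ y ∈ e, y ≠ x :=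
  ⟨_, Sym2.other_mem hx, Sym2.other_ne he hx⟩

/-- The number of edges of `E` at `v`. -/
noncomputable def edgeDeg {V : Type*} (E : Finset (Sym2 V)) (v : V) : ℕ :=
  (E.filter (fun e => v ∈ e)).card

theorem eq_of_edgeDeg_eq_one {V : Type*} {E : Finset (Sym2 V)} {v : V} (h : edgeDeg E v = 1)
    {e g : Sym2 V} (he : e ∈ E) (hve : v ∈ e) (hg : g ∈ E) (hvg : v ∈ g) : e = g :=
  Finset.card_le_one.1 (Eq.le h) e (by simp [*]) g (by simp [*])

theorem eq_or_eq_of_edgeDeg_le_two {V : Type*} {E : Finset (Sym2 V)} {v : V}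
    (h : edgeDeg E v ≤ 2) {e g k : Sym2 V} (he : e ∈ E) (hve : v ∈ e) (hg : g ∈ E) (hvg : v ∈ g)
    (hk : k ∈ E) (hvk : v ∈ k) : e = g ∨ e = k ∨ g = k := by
  by_contra! hne
  have : 2 < edgeDeg E v := Finset.two_lt_card.2
    ⟨e, by simp [*], g, by simp [*], k, by simp [*], hne.1, hne.2.1, hne.2.2⟩
  omega

theorem exists_edges_of_two_le_edgeDeg {V : Type*} {E : Finset (Sym2 V)} {v : V}
    (h : 2 ≤ edgeDeg E v) : ∃ e ∈ E, ∃ g ∈ E, v ∈ e ∧ v ∈ g ∧ e ≠ g := by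
  obtain ⟨e, he, g, hg, hne⟩ := Finset.one_lt_card.1 (show 1 < (E.filter (v ∈ ·)).card from h)
  simp only [Finset.mem_filter] at he hg
  exact ⟨e, he.1, g, hg.1, he.2, hg.2, hne⟩

theorem exists_edge_ne_of_two_le_edgeDeg {V : Type*} {E : Finset (Sym2 V)} {v : V}
    (h : 2 ≤ edgeDeg E v) (k : Sym2 V) : ∃ e ∈ E, v ∈ e ∧ e ≠ k := by
  obtain ⟨e, he, g, hg, hve, hvg, hne⟩ := exists_edges_of_two_le_edgeDeg h
  by_cases hk : e = k
  · exact ⟨g, hg, hvg, fun h => hne (hk.trans h.symm)⟩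
  · exact ⟨e, he, hve, hk⟩

/-- The number of elements of `D` with key at most that of `e`. -/
noncomputable def keyRank {α : Type*} (D : Finset α) (π : α → ℕ) (e : α) : ℕ :=
  (D.filter (fun g => π g ≤ π e)).card

theorem keyRank_le_keyRank {α : Type*} (D : Finset α) {π : α → ℕ} {e g : α} (h : π e ≤ π g) :
    keyRank D π e ≤ keyRank D π g :=
  Finset.card_le_card (fun x hx => by
    simp only [Finset.mem_filter] at hx ⊢
    exact ⟨hx.1, hx.2.trans h⟩)

theorem keyRank_lt_keyRank {α : Type*} {D : Finset α} {π : α → ℕ} {e g : α} (hg : g ∈ D)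
    (h : π e < π g) : keyRank D π e < keyRank D π g := by
  refine Finset.card_lt_card ((Finset.ssubset_iff_of_subset ?_).2 ⟨g, by simp [hg], by simp [h]⟩)
  intro x hx
  simp only [Finset.mem_filter] at hx ⊢
  exact ⟨hx.1, hx.2.trans h.le⟩

theorem keyRank_injOn {α : Type*} {D : Finset α} {π : α → ℕ} (hπ : Set.InjOn π D) :
    Set.InjOn (keyRank D π) D := by
  intro e he g hg h
  rcases lt_trichotomy (π e) (π g) with h' | h' | h'
  · exact absurd h (keyRank_lt_keyRank hg h').ne
  · exact hπ he hg h'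
  · exact absurd h (keyRank_lt_keyRank he h').ne'

theorem keyRank_eq_succ {α : Type*} {D : Finset α} {π : α → ℕ} (hπ : Set.InjOn π D) {e g : α}
    (hg : g ∈ D) (h : π e < π g) (hgap : ∀ x ∈ D, π x ≤ π e ∨ π g ≤ π x) :
    keyRank D π g = keyRank D π e + 1 := by
  unfold keyRank
  rw [← Finset.card_insert_of_notMem (a := g) (s := D.filter (fun x => π x ≤ π e))
    (by simp [h])]
  congr 1
  ext x
  simp only [Finset.mem_filter, Finset.mem_insert]
  constructor
  · rintro ⟨hx, hxg⟩
    rcases hgap x hx with h' | h'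
    · exact Or.inr ⟨hx, h'⟩
    · exact Or.inl (hπ hx hg (le_antisymm hxg h'))
  · rintro (rfl | ⟨hx, hxe⟩)
    · exact ⟨hg, le_rfl⟩
    · exact ⟨hx, hxe.trans h.le⟩

theorem bijOn_keyRank {α : Type*} {D : Finset α} {π : α → ℕ} (hπ : Set.InjOn π D) (h : ℕ) :
    Set.BijOn (fun e => h + keyRank D π e) D ↑(Finset.Ioc h (h + D.card)) := by
  have hinj : Set.InjOn (fun e => h + keyRank D π e) D := fun e he g hg heg =>
    keyRank_injOn hπ he hg (Nat.add_left_cancel heg)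
  have hmaps : ∀ e ∈ D, h + keyRank D π e ∈ Finset.Ioc h (h + D.card) := by
    intro e he
    have h1 : 0 < keyRank D π e := Finset.card_pos.2 ⟨e, by simp [he]⟩
    have h2 : keyRank D π e ≤ D.card := Finset.card_filter_le _ _
    rw [Finset.mem_Ioc]
    omega
  refine ⟨hmaps, hinj, ?_⟩
  have := Finset.surjOn_of_injOn_of_card_le (s := D) (t := Finset.Ioc h (h + D.card))
    (fun e => h + keyRank D π e) hmaps hinj (by simp)
  exact this

/-- An antimagic labelling from a linear layout of the unreserved edges: the edges in even
positions get the large labels in order, the remaining ones are labelled greedily. -/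
theorem exists_antimagic_of_layout {V : Type*} [Fintype V] {E : Finset (Sym2 V)}
    (hdeg : ∀ v, 1 ≤ edgeDeg E v)
    (hleaf : ∀ e ∈ E, ∀ x ∈ e, ∀ y ∈ e, edgeDeg E x = 1 → edgeDeg E y = 1 → x = y)
    {f : V → Sym2 V} (hfE : ∀ v, 3 ≤ edgeDeg E v → f v ∈ E) (hfv : ∀ v, 3 ≤ edgeDeg E v → v ∈ f v)
    (hfl : ∀ v, 3 ≤ edgeDeg E v → ∃ l ∈ f v, edgeDeg E l = 1)
    {E' : Finset (Sym2 V)} (hE' : ∀ e, e ∈ E' ↔ e ∈ E ∧ ∀ v, 3 ≤ edgeDeg E v → e ≠ f v)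
    {π : Sym2 V → ℕ} (hπ : Set.InjOn π E')
    (hlight : ∀ u, edgeDeg E u = 2 → ∀ e ∈ E', ∀ g ∈ E', u ∈ e → u ∈ g → e ≠ g →
      π e = π g + 1 ∨ π g = π e + 1)
    (hbig : ∀ w, 2 ≤ edgeDeg E w → ∃ e ∈ E', w ∈ e ∧ Even (π e) ∧ ∀ g ∈ E', Even (π g) →
      (∃ l ∈ g, edgeDeg E l = 1) → π g ≤ π e)
    (hpred : ∀ e ∈ E', ¬ Even (π e) → (∃ v ∈ e, 3 ≤ edgeDeg E v) → ∀ x ∈ E', Even (π x) →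
      (∀ l ∈ x, edgeDeg E l ≠ 1) → π x ≤ π e + 1 → ∃ y ∈ E', π y + 1 = π x)
    (hodd : ∀ e ∈ E', ¬ Even (π e) → ∃ u ∈ e, edgeDeg E u = 2) :
    ∃ φ : Sym2 V → ℕ, Set.BijOn φ ↑E ↑(Finset.Icc 1 E.card) ∧
      Function.Injective (fun v : V => ∑ e ∈ E.filter (fun e => v ∈ e), φ e) := by
  set D := E'.filter (fun e => Even (π e)) with hD
  set C := E'.filter (fun e => ¬ Even (π e)) with hC
  set T : Finset V := Finset.univ.filter (fun v => 3 ≤ edgeDeg E v) with hT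
  have memT : ∀ v, v ∈ T ↔ 3 ≤ edgeDeg E v := fun v => by simp [hT]
  have memD : ∀ e, e ∈ D ↔ e ∈ E' ∧ Even (π e) := fun e => by simp [hD]
  have memC : ∀ e, e ∈ C ↔ e ∈ E' ∧ ¬ Even (π e) := fun e => by simp only [hC, Finset.mem_filter]
  have hE'E : ∀ e ∈ E', e ∈ E := fun e he => ((hE' e).1 he).1
  have hDπ : Set.InjOn π D := hπ.mono (fun e he => ((memD e).1 he).1)
  have hfeq : ∀ v w, 3 ≤ edgeDeg E v → w ∈ f v → 2 ≤ edgeDeg E w → w = v := by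
    intro v w hv hw h2
    obtain ⟨l, hl, hl1⟩ := hfl v hv
    rcases Sym2.eq_or_eq_or_eq_of_mem hl hw (hfv v hv) with h | h | h
    · subst h; omega
    · subst h; omega
    · exact h
  have hfinj : Set.InjOn f T := by
    intro v hv w hw h
    have hv' := (memT v).1 hv
    have hw' := (memT w).1 hw
    exact hfeq w v hw' (h ▸ hfv v hv') (by omega)
  have hfE' : ∀ v ∈ T, f v ∉ E' := fun v hv h => ((hE' _).1 h).2 v ((memT v).1 hv) rfl
  set n := C.card + T.card with hn
  set δ : Sym2 V → ℕ := fun e => n + keyRank D π e with hδ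
  set l := (D.filter (fun e => ∃ l ∈ e, edgeDeg E l = 1)).card with hl
  have hsplit : E = D ∪ (C ∪ T.image f) := by
    ext e
    simp only [Finset.mem_union, memD, memC, Finset.mem_image, memT]
    constructor
    · intro he
      by_cases h : e ∈ E'
      · tauto
      · rw [hE'] at h
        push Not at h
        obtain ⟨v, hv, hve⟩ := h he
        exact Or.inr (Or.inr ⟨v, hv, hve.symm⟩)
    · rintro (h | h | ⟨v, hv, rfl⟩)
      · exact hE'E _ h.1
      · exact hE'E _ h.1
      · exact hfE v hv
  have hdisj : Disjoint D (C ∪ T.image f) := by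
    rw [Finset.disjoint_left]
    intro e he
    simp only [Finset.mem_union, memC, Finset.mem_image, not_or, not_exists, not_and]
    have he' := (memD e).1 he
    exact ⟨fun _ h => h he'.2, fun v hv h => hfE' v hv (h ▸ he'.1)⟩
  have hdisj2 : Disjoint C (T.image f) := by
    rw [Finset.disjoint_left]
    intro e he
    simp only [Finset.mem_image, not_exists, not_and]
    exact fun v hv h => hfE' v hv (h ▸ ((memC e).1 he).1)
  have hcardE : E.card = n + D.card := by
    rw [hsplit, Finset.card_union_of_disjoint hdisj, Finset.card_union_of_disjoint hdisj2,
      Finset.card_image_of_injOn hfinj]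
    omega
  -- the two edges at a vertex of degree two
  have hex : ∀ u, ∃ c g, edgeDeg E u = 2 → c ∈ C ∧ g ∈ D ∧ u ∈ c ∧ u ∈ g ∧
      (∀ k ∈ E, u ∈ k → k = c ∨ k = g) ∧ (π c = π g + 1 ∨ π g = π c + 1) := by
    intro u
    by_cases hu : edgeDeg E u = 2
    swap
    · exact ⟨s(u, u), s(u, u), fun h => absurd h hu⟩
    obtain ⟨e, he, g, hg, hue, hug, hne⟩ := exists_edges_of_two_le_edgeDeg hu.ge
    have hin : ∀ k ∈ E, u ∈ k → k ∈ E' := by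
      intro k hk huk
      refine (hE' k).2 ⟨hk, fun v hv h => ?_⟩
      obtain rfl := hfeq v u hv (h ▸ huk) hu.ge
      omega
    have hall : ∀ k ∈ E, u ∈ k → k = e ∨ k = g := by
      intro k hk huk
      rcases eq_or_eq_of_edgeDeg_le_two hu.le hk huk he hue hg hug with h | h | h
      · exact Or.inl h
      · exact Or.inr h
      · exact absurd h hne
    have hc := hlight u hu e (hin e he hue) g (hin g hg hug) hue hug hne
    by_cases hev : Even (π e)
    · have hg' : ¬ Even (π g) := by
        rcases hc with h | h <;> rw [h] at * <;> grind
      exact ⟨g, e, fun _ => ⟨(memC g).2 ⟨hin g hg hug, hg'⟩, (memD e).2 ⟨hin e he hue, hev⟩, hug,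
        hue, fun k hk huk => (hall k hk huk).symm, hc.symm⟩⟩
    · have hg' : Even (π g) := by
        rcases hc with h | h <;> rw [h] at * <;> grind
      exact ⟨e, g, fun _ => ⟨(memC e).2 ⟨hin e he hue, hev⟩, (memD g).2 ⟨hin g hg hug, hg'⟩, hue,
        hug, hall, hc⟩⟩
  choose cu ev hcu using hex
  have hcne : ∀ c ∈ C, ∀ g ∈ D, c ≠ g := fun c hc g hg h =>
    ((memC c).1 hc).2 (h ▸ ((memD g).1 hg).2)
  -- the large edge at a vertex of degree at least two
  have hbig' : ∀ w, 2 ≤ edgeDeg E w → ∃ e ∈ D, w ∈ e ∧ n + l ≤ δ e ∧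
      ∀ g ∈ D, (∃ l ∈ g, edgeDeg E l = 1) → δ g ≤ δ e := by
    intro w hw
    obtain ⟨e, he, hwe, hev, hmax⟩ := hbig w hw
    refine ⟨e, (memD e).2 ⟨he, hev⟩, hwe, ?_, ?_⟩
    · refine Nat.add_le_add_left (Finset.card_le_card ?_) _
      intro g hg
      rw [Finset.mem_filter] at hg ⊢
      have := (memD g).1 hg.1
      exact ⟨hg.1, hmax g this.1 this.2 hg.2⟩
    · intro g hg hgl
      have := (memD g).1 hg
      exact Nat.add_le_add_left (keyRank_le_keyRank D (hmax g this.1 this.2 hgl)) _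
  obtain ⟨ψ, hψ', s, hs1, hs2, -, hs4⟩ := exists_greedy_labelling
    {u : V | edgeDeg E u = 2} cu (fun u => δ (ev u)) π f (fun v => C.filter (fun e => v ∈ e))
    (n + l)
    (by
      intro u hu u' hu' hlt
      obtain ⟨h1, h2, -, -, -, h6⟩ := hcu u hu
      obtain ⟨h1', h2', -, -, -, h6'⟩ := hcu u' hu'
      refine Nat.add_le_add_left (keyRank_le_keyRank D ?_) _
      have := ((memC _).1 h1).2
      have := ((memC _).1 h1').2
      have := ((memD _).1 h2).2
      have := ((memD _).1 h2').2
      grind)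
    (by
      intro u hu u' hu' hne hcc
      obtain ⟨h1, h2, h3, h4, -, h6⟩ := hcu u hu
      obtain ⟨h1', h2', h3', h4', -, h6'⟩ := hcu u' hu'
      have hevne : ev u ≠ ev u' := by
        intro h
        refine hcne _ h1 _ h2 (Sym2.eq_of_two_common hne h3 (hcc ▸ h3') h4 (h ▸ h4'))
      have hπne : π (ev u) ≠ π (ev u') := fun h => hevne (hDπ h2 h2' h)
      rw [← hcc] at h6'
      have hodd1 := ((memC _).1 h1).2
      have hgap : ∀ x ∈ D, π x ≠ π (cu u) := fun x hx h => hodd1 (h ▸ ((memD x).1 hx).2)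
      rcases h6 with h | h
      · have hlt : π (ev u) < π (ev u') := by omega
        have := keyRank_eq_succ hDπ h2' hlt (fun x hx => by have := hgap x hx; omega)
        simp only [hδ]
        omega
      · have hlt : π (ev u') < π (ev u) := by omega
        have := keyRank_eq_succ hDπ h2 hlt (fun x hx => by have := hgap x hx; omega)
        simp only [hδ]
        omega)
    n C T 0 0 (fun v => ∑ e ∈ D.filter (fun e => v ∈ e), δ e) rfl
    (hπ.mono (fun e he => ((memC e).1 he).1))
    (by
      intro e he
      have he' := (memC e).1 he
      obtain ⟨u, hue, hu⟩ := hodd e he'.1 he'.2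
      obtain ⟨h1, h2, h3, h4, h5, h6⟩ := hcu u hu
      rcases h5 e (hE'E e he'.1) hue with h | h
      · exact ⟨u, hu, h.symm⟩
      · exact absurd h (hcne _ he _ h2))
    hfinj
    (fun v hv h => hfE' v hv ((memC _).1 h).1)
    (fun v hv h => by
      have h1 := (memT v).1 hv
      have h2 : edgeDeg E v = 2 := h
      omega)
    (fun v hv _ => by
      have h1 := (memT v).1 hv
      obtain ⟨e, he, hve, -, -⟩ := hbig' v (by omega)
      omega)
    (fun u hu _ => by omega)
    (fun v hv => by
      have h1 := (memT v).1 hv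
      obtain ⟨e, he, hve, h, -⟩ := hbig' v (by omega)
      exact h.trans (Finset.single_le_sum (f := δ) (fun _ _ => Nat.zero_le _)
        (Finset.mem_filter.2 ⟨he, hve⟩)))
    (by
      intro v hv u hu hX hcC
      obtain ⟨h1, h2, h3, h4, h5, h6⟩ := hcu u hu
      have hvc := (Finset.mem_filter.1 hX).2
      have h1' := (memC _).1 h1
      have key : keyRank D π (ev u) ≤ l + (C.filter (fun e => π e ≤ π (cu u))).card := by
        have hsub : D.filter (fun g => π g ≤ π (ev u)) ⊆
            D.filter (fun e => ∃ l ∈ e, edgeDeg E l = 1) ∪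
            D.filter (fun g => π g ≤ π (ev u) ∧ ¬ ∃ l ∈ g, edgeDeg E l = 1) := by
          intro g hg
          simp only [Finset.mem_union, Finset.mem_filter] at hg ⊢
          by_cases hgl : ∃ l ∈ g, edgeDeg E l = 1
          · exact Or.inl ⟨hg.1, hgl⟩
          · exact Or.inr ⟨hg.1, hg.2, hgl⟩
        refine (Finset.card_le_card hsub).trans ((Finset.card_union_le _ _).trans
          (Nat.add_le_add_left ?_ _))
        have hy : ∀ x ∈ D.filter (fun g => π g ≤ π (ev u) ∧ ¬ ∃ l ∈ g, edgeDeg E l = 1),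
            ∃ y ∈ E', π y + 1 = π x := by
          intro x hx
          rw [Finset.mem_filter] at hx
          have hx' := (memD x).1 hx.1
          exact hpred (cu u) h1'.1 h1'.2 ⟨v, hvc, (memT v).1 hv⟩ x hx'.1 hx'.2
            (fun l hl hl1 => hx.2.2 ⟨l, hl, hl1⟩) (by omega)
        choose! y hyE hyπ using hy
        refine Finset.card_le_card_of_injOn y ?_ ?_
        · intro x hx
          have hx1 := Finset.mem_filter.1 hx
          have hx' := (memD x).1 hx1.1
          have h7 := hyπ x hx
          have h8 := hx'.2
          refine Finset.mem_filter.2 ⟨(memC _).2 ⟨hyE x hx, ?_⟩, by omega⟩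
          rw [← h7] at h8
          grind
        · intro x hx x' hx' hxx
          have h7 := hyπ x hx
          have h8 := hyπ x' hx'
          rw [hxx] at h7
          exact hDπ (Finset.mem_filter.1 hx).1 (Finset.mem_filter.1 hx').1 (by omega)
      simp only [hδ]
      omega)
    (by
      intro v hv u hu u' hu' hX hcc
      have h3 := (hcu u hu).2.2.1
      have h3' := (hcu u' hu').2.2.1
      have hvc := (Finset.mem_filter.1 hX).2
      have h1 := (memT v).1 hv
      have hu2 : edgeDeg E u = 2 := hu
      have hu2' : edgeDeg E u' = 2 := hu'
      rcases Sym2.eq_or_eq_or_eq_of_mem hvc h3 (hcc ▸ h3') with h | h | h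
      · subst h; omega
      · subst h; omega
      · exact h.symm)
  have hψ : Set.BijOn ψ ↑(C ∪ T.image f) ↑(Finset.Ioc 0 n) := by
    rw [zero_add] at hψ'
    convert hψ'
  set φ : Sym2 V → ℕ := fun e => if e ∈ D then δ e else ψ e with hφ
  have hφD : ∀ e ∈ D, φ e = δ e := fun e he => if_pos he
  have hφC : ∀ e ∈ C ∪ T.image f, φ e = ψ e := fun e he =>
    if_neg (fun h => Finset.disjoint_left.1 hdisj h he)
  have hbij : Set.BijOn φ ↑E ↑(Finset.Icc 1 E.card) := by
    have hb1 : Set.BijOn φ D ↑(Finset.Ioc n (n + D.card)) :=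
      (bijOn_keyRank hDπ n).congr (fun e he => (hφD e he).symm)
    have hb2 : Set.BijOn φ ↑(C ∪ T.image f) ↑(Finset.Ioc 0 n) :=
      hψ.congr (fun e he => (hφC e (Finset.mem_coe.1 he)).symm)
    have hb := hb1.union hb2 (by
      rw [Set.injOn_union (by rw [← Finset.disjoint_coe] at hdisj; exact hdisj)]
      refine ⟨hb1.injOn, hb2.injOn, fun a ha b hb h => ?_⟩
      have h1 := Finset.mem_Ioc.1 (hb1.mapsTo ha)
      have h2 := Finset.mem_Ioc.1 (hb2.mapsTo hb)
      omega)
    rw [← Finset.coe_union, ← hsplit, ← Finset.coe_union] at hb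
    convert hb using 2
    ext x
    simp only [Finset.mem_Icc, Finset.mem_union, Finset.mem_Ioc]
    omega
  have hpos : ∀ e ∈ E, 1 ≤ φ e := fun e he => (Finset.mem_Icc.1 (hbij.mapsTo he)).1
  have hinc : ∀ v, E.filter (fun e => v ∈ e) = D.filter (fun e => v ∈ e) ∪
      (C.filter (fun e => v ∈ e) ∪ (T.image f).filter (fun e => v ∈ e)) := by
    intro v
    conv_lhs => rw [hsplit]
    rw [Finset.filter_union, Finset.filter_union]
  have hsum : ∀ v, ∑ e ∈ E.filter (fun e => v ∈ e), φ e = ∑ e ∈ D.filter (fun e => v ∈ e), δ e +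
      (∑ e ∈ C.filter (fun e => v ∈ e), ψ e + ∑ e ∈ (T.image f).filter (fun e => v ∈ e), ψ e) := by
    intro v
    rw [hinc, Finset.sum_union, Finset.sum_union]
    · congr 1
      · exact Finset.sum_congr rfl (fun e he => hφD e (Finset.mem_filter.1 he).1)
      · congr 1
        · exact Finset.sum_congr rfl (fun e he =>
            hφC e (Finset.mem_union_left _ (Finset.mem_filter.1 he).1))
        · exact Finset.sum_congr rfl (fun e he =>
            hφC e (Finset.mem_union_right _ (Finset.mem_filter.1 he).1))
    · exact Finset.disjoint_filter_filter hdisj2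
    · rw [← Finset.filter_union]
      exact Finset.disjoint_filter_filter hdisj
  have hs : ∀ v, 2 ≤ edgeDeg E v → ∑ e ∈ E.filter (fun e => v ∈ e), φ e = s v := by
    intro v hv
    by_cases h3 : 3 ≤ edgeDeg E v
    · have hvT := (memT v).2 h3
      rw [hs2 v hvT, hsum, add_assoc]
      congr 2
      · congr 1
        ext e
        simpa using fun h _ => h
      · rw [← Finset.sum_singleton ψ (f v)]
        congr 1
        ext e
        simp only [Finset.mem_filter, Finset.mem_image, Finset.mem_singleton]
        constructor
        · rintro ⟨⟨w, hw, rfl⟩, hvw⟩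
          rw [hfeq w v ((memT w).1 hw) hvw hv]
        · rintro rfl
          exact ⟨⟨v, hvT, rfl⟩, hfv v h3⟩
    · have hv2 : edgeDeg E v = 2 := by omega
      obtain ⟨h1, h2, h3, h4, h5, h6⟩ := hcu v hv2
      have hpair : E.filter (fun e => v ∈ e) = {cu v, ev v} := by
        ext e
        simp only [Finset.mem_filter, Finset.mem_insert, Finset.mem_singleton]
        constructor
        · rintro ⟨he, hve⟩
          exact h5 e he hve
        · rintro (rfl | rfl)
          · exact ⟨hE'E _ ((memC _).1 h1).1, h3⟩
          · exact ⟨hE'E _ ((memD _).1 h2).1, h4⟩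
      rw [hpair, Finset.sum_pair (hcne _ h1 _ h2), hs1 v hv2 h1, hφD _ h2,
        hφC _ (Finset.mem_union_left _ h1), add_comm]
  have hleafsum : ∀ v, edgeDeg E v = 1 → ∃ e ∈ E, v ∈ e ∧
      ∑ e ∈ E.filter (fun e => v ∈ e), φ e = φ e := by
    intro v hv
    obtain ⟨e, he⟩ := Finset.card_eq_one.1 (show (E.filter (v ∈ ·)).card = 1 from hv)
    have hm : e ∈ E.filter (v ∈ ·) := by rw [he]; simp
    rw [Finset.mem_filter] at hm
    exact ⟨e, hm.1, hm.2, by rw [he, Finset.sum_singleton]⟩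
  have hleafne : ∀ v w, edgeDeg E v = 1 → 2 ≤ edgeDeg E w →
      ∑ e ∈ E.filter (fun e => v ∈ e), φ e < ∑ e ∈ E.filter (fun e => w ∈ e), φ e := by
    intro v w hv hw
    obtain ⟨e, he, hve, hsv⟩ := hleafsum v hv
    obtain ⟨b, hbD, hwb, -, hmax⟩ := hbig' w hw
    obtain ⟨g, hg, hwg, hgb⟩ := exists_edge_ne_of_two_le_edgeDeg hw b
    have hbE := hE'E _ ((memD b).1 hbD).1
    have hle : φ e ≤ φ b := by
      rw [hφD b hbD]
      by_cases heD : e ∈ D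
      · rw [hφD e heD]
        exact hmax e heD ⟨v, hve, hv⟩
      · have he' : e ∈ C ∪ T.image f := by
          rw [hsplit, Finset.mem_union] at he
          exact he.resolve_left heD
        have := Finset.mem_Ioc.1 (hψ.mapsTo (Finset.mem_coe.2 he'))
        rw [hφC e he']
        simp only [hδ]
        omega
    have h2 : ∑ e ∈ ({b, g} : Finset (Sym2 V)), φ e ≤ ∑ e ∈ E.filter (fun e => w ∈ e), φ e := by
      refine Finset.sum_le_sum_of_subset ?_
      intro x hx
      simp only [Finset.mem_insert, Finset.mem_singleton] at hx
      rcases hx with rfl | rfl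
      · exact Finset.mem_filter.2 ⟨hbE, hwb⟩
      · exact Finset.mem_filter.2 ⟨hg, hwg⟩
    rw [Finset.sum_pair hgb.symm] at h2
    have := hpos g hg
    omega
  refine ⟨φ, hbij, fun v w hvw => ?_⟩
  simp only at hvw
  have hv := hdeg v
  have hw := hdeg w
  by_cases h1 : edgeDeg E v = 1 <;> by_cases h2 : edgeDeg E w = 1
  · obtain ⟨e, he, hve, hsv⟩ := hleafsum v h1
    obtain ⟨g, hg, hwg, hsw⟩ := hleafsum w h2
    have heg : e = g := hbij.injOn he hg (by rw [← hsv, ← hsw, hvw])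
    exact hleaf e he v hve w (heg ▸ hwg) h1 h2
  · have := hleafne v w h1 (by omega)
    omega
  · have := hleafne w v h2 (by omega)
    omega
  · rw [hs v (by omega), hs w (by omega)] at hvw
    refine hs4 v w ?_ ?_ hvw
    · by_cases h3 : 3 ≤ edgeDeg E v
      · exact Or.inl ((memT v).2 h3)
      · have h4 : edgeDeg E v = 2 := by omega
        exact Or.inr ⟨h4, (hcu v h4).1⟩
    · by_cases h3 : 3 ≤ edgeDeg E w
      · exact Or.inl ((memT w).2 h3)
      · have h4 : edgeDeg E w = 2 := by omega
        exact Or.inr ⟨h4, (hcu w h4).1⟩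

/-- The graph on edges in which two edges of `E` are adjacent when they share a vertex of `L`. -/
def edgeGraphAt {V : Type*} (E : Finset (Sym2 V)) (L : Set V) : SimpleGraph (Sym2 V) where
  Adj e g := e ≠ g ∧ e ∈ E ∧ g ∈ E ∧ ∃ u ∈ L, u ∈ e ∧ u ∈ g
  symm := ⟨fun _ _ ⟨h1, h2, h3, u, hu, h4, h5⟩ => ⟨h1.symm, h3, h2, u, hu, h5, h4⟩⟩
  loopless := ⟨fun _ h => h.1 rfl⟩

section edgeGraphAt

variable {V : Type*} {E : Finset (Sym2 V)} {L : Set V}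

theorem edgeGraphAt_adj_mem_or (hL : ∀ u ∈ L, edgeDeg E u ≤ 2) {e g₁ g₂ g₃ : Sym2 V}
    (h1 : (edgeGraphAt E L).Adj e g₁) (h2 : (edgeGraphAt E L).Adj e g₂)
    (h3 : (edgeGraphAt E L).Adj e g₃) : g₁ = g₂ ∨ g₁ = g₃ ∨ g₂ = g₃ := by
  obtain ⟨n1, he, hg1, u1, hu1, hu1e, hu1g⟩ := h1
  obtain ⟨n2, -, hg2, u2, hu2, hu2e, hu2g⟩ := h2
  obtain ⟨n3, -, hg3, u3, hu3, hu3e, hu3g⟩ := h3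
  rcases Sym2.eq_or_eq_or_eq_of_mem hu1e hu2e hu3e with h | h | h
  · subst h
    have := eq_or_eq_of_edgeDeg_le_two (hL u1 hu1) he hu1e hg1 hu1g hg2 hu2g
    tauto
  · subst h
    have := eq_or_eq_of_edgeDeg_le_two (hL u1 hu1) he hu1e hg1 hu1g hg3 hu3g
    tauto
  · subst h
    have := eq_or_eq_of_edgeDeg_le_two (hL u2 hu2) he hu2e hg2 hu2g hg3 hu3g
    tauto

theorem edgeGraphAt_adj_unique (hL : ∀ u ∈ L, edgeDeg E u ≤ 2) {e g₁ g₂ : Sym2 V} {w : V}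
    (hw : w ∈ e) (hwL : w ∉ L) (h1 : (edgeGraphAt E L).Adj e g₁)
    (h2 : (edgeGraphAt E L).Adj e g₂) : g₁ = g₂ := by
  obtain ⟨n1, he, hg1, u1, hu1, hu1e, hu1g⟩ := h1
  obtain ⟨n2, -, hg2, u2, hu2, hu2e, hu2g⟩ := h2
  rcases Sym2.eq_or_eq_or_eq_of_mem hw hu1e hu2e with h | h | h
  · exact absurd (h ▸ hu1) hwL
  · exact absurd (h ▸ hu2) hwL
  · subst h
    have := eq_or_eq_of_edgeDeg_le_two (hL u1 hu1) he hu1e hg1 hu1g hg2 hu2g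
    tauto

theorem edgeGraphAt_mem_of_reachable {e g : Sym2 V} (he : e ∈ E)
    (h : (edgeGraphAt E L).Reachable e g) : g ∈ E := by
  obtain ⟨p⟩ := h
  induction p with
  | nil => exact he
  | cons h _ ih => exact ih h.2.2.1

theorem edgeGraphAt_eq_of_reachable {e g : Sym2 V} (he : ∀ u ∈ e, u ∉ L)
    (h : (edgeGraphAt E L).Reachable e g) : e = g := by
  obtain ⟨p⟩ := h
  cases p with
  | nil => rfl
  | cons h _ =>
    obtain ⟨-, -, -, u, hu, hue, -⟩ := h
    exact absurd hu (he u hue)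

/-- The vertices covered by a component are closed under adjacency as long as edges leave it only
through vertices of `L` or of degree one. -/
theorem edgeGraphAt_cover_eq_univ
    (hconn : ∀ X : Set V, X.Nonempty → (∀ e ∈ E, ∀ x ∈ e, ∀ y ∈ e, x ∈ X → y ∈ X) →
      X = Set.univ) {e : Sym2 V} (he : e ∈ E)
    (hcl : ∀ g, (edgeGraphAt E L).Reachable e g → ∀ x ∈ g, x ∉ L → ∀ k ∈ E, x ∈ k →
      (edgeGraphAt E L).Reachable e k) (x : V) :
    ∃ g, (edgeGraphAt E L).Reachable e g ∧ x ∈ g := by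
  have : {x : V | ∃ g, (edgeGraphAt E L).Reachable e g ∧ x ∈ g} = Set.univ := by
    refine hconn _ ?_ ?_
    · induction e with
      | _ a b => exact ⟨a, s(a, b), SimpleGraph.Reachable.refl _, Sym2.mem_mk_left a b⟩
    · rintro k hk x hx y hy ⟨g, hg, hxg⟩
      refine ⟨k, ?_, hy⟩
      by_cases hxL : x ∈ L
      · by_cases hgk : g = k
        · exact hgk ▸ hg
        · exact hg.trans (SimpleGraph.Adj.reachable
            ⟨hgk, edgeGraphAt_mem_of_reachable he hg, hk, x, hxL, hxg, hx⟩)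
      · exact hcl g hg x hxg hxL k hk hx
  exact (Set.ext_iff.1 this x).2 trivial

end edgeGraphAt

/-- Keys that list the components one after the other by class, and each component by the distance
to its starting point. -/
theorem exists_component_keys {α : Type*} [Finite α] (H : SimpleGraph α)
    (cl ε : H.ConnectedComponent → ℕ) (hε : ∀ K, ε K ≤ 1) (st : H.ConnectedComponent → α) :
    ∃ π : α → ℕ,
      (∀ e, Even (π e) ↔ Even (ε (H.connectedComponentMk e) +
        H.dist (st (H.connectedComponentMk e)) e)) ∧
      (∀ e g, H.connectedComponentMk e = H.connectedComponentMk g →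
        π e + H.dist (st (H.connectedComponentMk g)) g =
          π g + H.dist (st (H.connectedComponentMk e)) e) ∧
      (∀ e g, cl (H.connectedComponentMk e) < cl (H.connectedComponentMk g) → π e + 1 < π g) ∧
      (∀ e g, π e = π g → H.connectedComponentMk e = H.connectedComponentMk g) := by
  obtain ⟨M, hM⟩ : ∃ M, ∀ e, H.dist (st (H.connectedComponentMk e)) e ≤ M := by
    obtain ⟨M, hM⟩ := (Set.finite_range
      (fun e => H.dist (st (H.connectedComponentMk e)) e)).bddAbove
    exact ⟨M, fun e => hM ⟨e, rfl⟩⟩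
  obtain ⟨N, ⟨idx⟩⟩ := Finite.exists_equiv_fin H.ConnectedComponent
  set ρ : H.ConnectedComponent → ℕ := fun K => N * cl K + idx K with hρ
  have hlt : ∀ K, (idx K : ℕ) < N := fun K => (idx K).2
  have hρlt : ∀ K K', cl K < cl K' → ρ K < ρ K' := by
    intro K K' h
    have h1 := hlt K
    have h2 : N * (cl K + 1) ≤ N * cl K' := Nat.mul_le_mul_left _ h
    simp only [hρ]
    rw [Nat.mul_add, Nat.mul_one] at h2
    omega
  have hρinj : ∀ K K', ρ K = ρ K' → K = K' := by
    intro K K' h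
    rcases lt_trichotomy (cl K) (cl K') with h' | h' | h'
    · exact absurd h (hρlt _ _ h').ne
    · simp only [hρ, h'] at h
      exact idx.injective (Fin.ext (Nat.add_left_cancel h))
    · exact absurd h (hρlt _ _ h').ne'
  have hbig : ∀ e g, ρ (H.connectedComponentMk e) < ρ (H.connectedComponentMk g) →
      2 * (M + 2) * ρ (H.connectedComponentMk e) + ε (H.connectedComponentMk e) +
        H.dist (st (H.connectedComponentMk e)) e + 1 <
      2 * (M + 2) * ρ (H.connectedComponentMk g) + ε (H.connectedComponentMk g) +
        H.dist (st (H.connectedComponentMk g)) g := by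
    intro e g h
    have h2 : 2 * (M + 2) * (ρ (H.connectedComponentMk e) + 1) ≤
      2 * (M + 2) * ρ (H.connectedComponentMk g) := Nat.mul_le_mul_left _ h
    rw [Nat.mul_add, Nat.mul_one] at h2
    have := hM e
    have := hε (H.connectedComponentMk e)
    omega
  refine ⟨fun e => 2 * (M + 2) * ρ (H.connectedComponentMk e) + ε (H.connectedComponentMk e) +
    H.dist (st (H.connectedComponentMk e)) e, ?_, ?_, fun e g h => hbig e g (hρlt _ _ h), ?_⟩
  · intro e
    beta_reduce
    rw [add_assoc, mul_assoc, Nat.even_add]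
    simp
  · intro e g h
    simp only [h]
    omega
  · intro e g h
    rcases lt_trichotomy (ρ (H.connectedComponentMk e)) (ρ (H.connectedComponentMk g))
      with h' | h' | h'
    · have := hbig e g h'
      simp only at h
      omega
    · exact hρinj _ _ h'
    · have := hbig g e h'
      simp only at h
      omega

/-- The edge set of a connected graph on `V` with a vertex of degree at least three. -/
structure IsBranchedEdgeSet {V : Type*} (E : Finset (Sym2 V)) : Prop where
  not_isDiag : ∀ e ∈ E, ¬ e.IsDiag
  one_le : ∀ v, 1 ≤ edgeDeg E v
  conn : ∀ X : Set V, X.Nonempty → (∀ e ∈ E, ∀ x ∈ e, ∀ y ∈ e, x ∈ X → y ∈ X) → X = Set.univ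
  exists_three_le : ∃ v, 3 ≤ edgeDeg E v

/-- `f` picks an edge to a leaf at every vertex of degree at least three. -/
def IsLeafChoice {V : Type*} (E : Finset (Sym2 V)) (f : V → Sym2 V) : Prop :=
  ∀ v, 3 ≤ edgeDeg E v → f v ∈ E ∧ v ∈ f v ∧ ∃ l ∈ f v, edgeDeg E l = 1

/-- Edges sharing a vertex of degree two are adjacent; the components are the threads. -/
abbrev threadGraph {V : Type*} (E : Finset (Sym2 V)) : SimpleGraph (Sym2 V) :=
  edgeGraphAt E {u | edgeDeg E u = 2}

/-- An edge with an end of degree other than two. -/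
def IsEndEdge {V : Type*} (E : Finset (Sym2 V)) (e : Sym2 V) : Prop :=
  e ∈ E ∧ ∃ w ∈ e, edgeDeg E w ≠ 2

/-- A thread with an edge to a leaf. -/
def HasLeafEdge {V : Type*} (E : Finset (Sym2 V)) (K : (threadGraph E).ConnectedComponent) :
    Prop :=
  ∃ g ∈ E, (threadGraph E).connectedComponentMk g = K ∧ ∃ l ∈ g, edgeDeg E l = 1

/-- The thread is a single edge from a leaf to a vertex of degree at least three. -/
def IsPendant {V : Type*} (E : Finset (Sym2 V)) (K : (threadGraph E).ConnectedComponent) : Prop :=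
  ∃ g ∈ E, (threadGraph E).connectedComponentMk g = K ∧ (∃ l ∈ g, edgeDeg E l = 1) ∧
    ∃ v ∈ g, 3 ≤ edgeDeg E v

/-- The end edges of the thread are at even distance. -/
def IsEvenThread {V : Type*} (E : Finset (Sym2 V)) (K : (threadGraph E).ConnectedComponent) :
    Prop :=
  ∀ g g', IsEndEdge E g → IsEndEdge E g' → (threadGraph E).connectedComponentMk g = K →
    (threadGraph E).connectedComponentMk g' = K → Even ((threadGraph E).dist g g')

section Threads

variable {V : Type*} {E : Finset (Sym2 V)}

theorem threadGraph_adj_mem_or (e g₁ g₂ g₃ : Sym2 V) (h1 : (threadGraph E).Adj e g₁)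
    (h2 : (threadGraph E).Adj e g₂) (h3 : (threadGraph E).Adj e g₃) :
    g₁ = g₂ ∨ g₁ = g₃ ∨ g₂ = g₃ :=
  edgeGraphAt_adj_mem_or (fun _ hu => Eq.le hu) h1 h2 h3

theorem IsEndEdge.adj_unique {e : Sym2 V} (he : IsEndEdge E e) (g₁ g₂ : Sym2 V)
    (h1 : (threadGraph E).Adj e g₁) (h2 : (threadGraph E).Adj e g₂) : g₁ = g₂ := by
  obtain ⟨-, w, hw, hwL⟩ := he
  exact edgeGraphAt_adj_unique (fun _ hu => Eq.le hu) hw hwL h1 h2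

theorem IsEndEdge.eq_or_eq_or_eq {a x y : Sym2 V} (ha : IsEndEdge E a) (hx : IsEndEdge E x)
    (hy : IsEndEdge E y) (hax : (threadGraph E).Reachable a x)
    (hay : (threadGraph E).Reachable a y) : a = x ∨ a = y ∨ x = y :=
  eq_or_eq_or_eq_of_degree_le_one threadGraph_adj_mem_or ha.adj_unique hx.adj_unique
    hy.adj_unique hax hay

theorem threadGraph_eq_of_reachable {e g : Sym2 V} (he : ∀ u ∈ e, edgeDeg E u ≠ 2)
    (h : (threadGraph E).Reachable e g) : e = g :=
  edgeGraphAt_eq_of_reachable he h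

namespace IsBranchedEdgeSet

theorem leaf_eq (hE : IsBranchedEdgeSet E) {e : Sym2 V} (he : e ∈ E) {x y : V} (hx : x ∈ e)
    (hy : y ∈ e) (h1x : edgeDeg E x = 1) (h1y : edgeDeg E y = 1) : x = y := by
  by_contra hxy
  have : {z | z ∈ e} = Set.univ := by
    refine hE.conn _ ⟨x, hx⟩ ?_
    intro k hk a hak b hbk hae
    rcases Sym2.eq_or_eq_or_eq_of_mem (show a ∈ e from hae) hx hy with h | h | h
    · subst h
      exact eq_of_edgeDeg_eq_one h1x hk hak he hae ▸ hbk
    · subst h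
      exact eq_of_edgeDeg_eq_one h1y hk hak he hae ▸ hbk
    · exact absurd h hxy
  obtain ⟨v, hv⟩ := hE.exists_three_le
  have hve : v ∈ e := (Set.ext_iff.1 this v).2 trivial
  rcases Sym2.eq_or_eq_or_eq_of_mem hve hx hy with h | h | h
  · subst h; omega
  · subst h; omega
  · exact hxy h

theorem exists_reachable_branch (hE : IsBranchedEdgeSet E) {e : Sym2 V} (he : e ∈ E) :
    ∃ g ∈ E, (threadGraph E).Reachable e g ∧ ∃ v ∈ g, 3 ≤ edgeDeg E v := by
  by_contra! hno
  obtain ⟨v, hv⟩ := hE.exists_three_le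
  obtain ⟨g, hg, hvg⟩ := edgeGraphAt_cover_eq_univ (L := {u | edgeDeg E u = 2}) hE.conn he (by
    intro g hg x hx hxL k hk hxk
    have hgE := edgeGraphAt_mem_of_reachable he hg
    have h1 := hno g hgE hg x hx
    have h2 := hE.one_le x
    have h3 : edgeDeg E x ≠ 2 := hxL
    rwa [eq_of_edgeDeg_eq_one (show edgeDeg E x = 1 by omega) hk hxk hgE hx]) v
  have := hno g (edgeGraphAt_mem_of_reachable he hg) hg v hvg
  omega

/-- An edge to a leaf without an end of degree two joins a leaf to a branch vertex. -/
theorem exists_branch_mem (hE : IsBranchedEdgeSet E) {e : Sym2 V} (he : e ∈ E) {l : V}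
    (hl : l ∈ e) (hl1 : edgeDeg E l = 1) (h2 : ∀ u ∈ e, edgeDeg E u ≠ 2) :
    ∃ v ∈ e, 3 ≤ edgeDeg E v := by
  obtain ⟨v, hv, hvl⟩ := Sym2.exists_mem_ne (hE.not_isDiag e he) hl
  refine ⟨v, hv, ?_⟩
  have h3 := hE.one_le v
  have h4 := h2 v hv
  have h5 : edgeDeg E v ≠ 1 := fun h => hvl (hE.leaf_eq he hv hl h hl1)
  omega

theorem ne_two_of_mem (hE : IsBranchedEdgeSet E) {e : Sym2 V} {l v : V}
    (hl : l ∈ e) (hl1 : edgeDeg E l = 1) (hv : v ∈ e) (hv3 : 3 ≤ edgeDeg E v) :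
    ∀ u ∈ e, edgeDeg E u ≠ 2 := by
  intro u hu h2
  have := hE.one_le u
  rcases Sym2.eq_or_eq_or_eq_of_mem hu hl hv with h | h | h <;> subst h <;> omega

theorem leafEdge_eq (hE : IsBranchedEdgeSet E) {e g : Sym2 V} (he : e ∈ E)
    (hr : (threadGraph E).Reachable e g) (hle : ∃ l ∈ e, edgeDeg E l = 1)
    (hlg : ∃ l ∈ g, edgeDeg E l = 1) : e = g := by
  have hg := edgeGraphAt_mem_of_reachable he hr
  obtain ⟨l, hl, hl1⟩ := hle
  obtain ⟨l', hl', hl1'⟩ := hlg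
  obtain ⟨k, hk, hek, v, hv, hv3⟩ := hE.exists_reachable_branch he
  rcases IsEndEdge.eq_or_eq_or_eq (a := e) (x := g) (y := k) ⟨he, l, hl, by omega⟩
    ⟨hg, l', hl', by omega⟩ ⟨hk, v, hv, by omega⟩ hr hek with h | h | h
  · exact h
  · subst h
    exact threadGraph_eq_of_reachable (hE.ne_two_of_mem hl hl1 hv hv3) hr
  · subst h
    exact (threadGraph_eq_of_reachable (hE.ne_two_of_mem hl' hl1' hv hv3) hr.symm).symm

theorem isEvenThread_of_no_light {K : (threadGraph E).ConnectedComponent} {e : Sym2 V}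
    (he : (threadGraph E).connectedComponentMk e = K)
    (h2 : ∀ u ∈ e, edgeDeg E u ≠ 2) : IsEvenThread E K := by
  intro g g' _ _ hg hg'
  have h := threadGraph_eq_of_reachable h2 (SimpleGraph.ConnectedComponent.exact (he.trans hg.symm))
  have h' := threadGraph_eq_of_reachable h2
    (SimpleGraph.ConnectedComponent.exact (he.trans hg'.symm))
  subst h h'
  simp

theorem odd_dist_of_not_isEvenThread {K : (threadGraph E).ConnectedComponent}
    (hK : ¬ IsEvenThread E K) {e g : Sym2 V} (he : IsEndEdge E e) (hg : IsEndEdge E g)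
    (heK : (threadGraph E).connectedComponentMk e = K)
    (hgK : (threadGraph E).connectedComponentMk g = K) (hne : e ≠ g) :
    ¬ Even ((threadGraph E).dist e g) := by
  intro hev
  refine hK (fun x y hx hy hxK hyK => ?_)
  have hex := SimpleGraph.ConnectedComponent.exact (heK.trans hxK.symm)
  have hey := SimpleGraph.ConnectedComponent.exact (heK.trans hyK.symm)
  have heg := SimpleGraph.ConnectedComponent.exact (heK.trans hgK.symm)
  have h1 := IsEndEdge.eq_or_eq_or_eq he hg hx heg hex
  have h2 := IsEndEdge.eq_or_eq_or_eq he hg hy heg hey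
  rcases h1 with h1 | h1 | h1
  · exact absurd h1 hne
  all_goals
    subst h1
    rcases h2 with h2 | h2 | h2
    · exact absurd h2 hne
    all_goals
      subst h2
      first
        | exact hev
        | (rw [SimpleGraph.dist_comm]; exact hev)
        | simp

end IsBranchedEdgeSet

end Threads

/-- An antimagic labelling from an even thread with a leaf edge (which may be a reserved pendant
edge) and an injective assignment of odd threads between branch vertices. -/
theorem IsBranchedEdgeSet.exists_antimagic_of_assignment {V : Type*} [Fintype V]
    {E : Finset (Sym2 V)} (hE : IsBranchedEdgeSet E) {f : V → Sym2 V} (hf : IsLeafChoice E f)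
    {K₀ : (threadGraph E).ConnectedComponent} (hK₀l : HasLeafEdge E K₀) (hK₀e : IsEvenThread E K₀)
    {A : Set V} {a : V → Sym2 V} (haE : ∀ v ∈ A, a v ∈ E) (hav : ∀ v ∈ A, v ∈ a v)
    (hA3 : ∀ v ∈ A, 3 ≤ edgeDeg E v)
    (hal : ∀ v ∈ A, ¬ HasLeafEdge E ((threadGraph E).connectedComponentMk (a v)))
    (hae : ∀ v ∈ A, ¬ IsEvenThread E ((threadGraph E).connectedComponentMk (a v)))
    (hainj : ∀ v ∈ A, ∀ w ∈ A, (threadGraph E).Reachable (a v) (a w) → v = w)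
    (hcover : ∀ v, 3 ≤ edgeDeg E v → v ∈ A ∨ ∃ e ∈ E, v ∈ e ∧
      (∀ w, 3 ≤ edgeDeg E w → e ≠ f w) ∧ ((threadGraph E).connectedComponentMk e = K₀ ∨
        (IsEvenThread E ((threadGraph E).connectedComponentMk e) ↔
          ¬ HasLeafEdge E ((threadGraph E).connectedComponentMk e)))) :
    ∃ φ : Sym2 V → ℕ, Set.BijOn φ ↑E ↑(Finset.Icc 1 E.card) ∧
      Function.Injective (fun v : V => ∑ e ∈ E.filter (fun e => v ∈ e), φ e) := by
  have hmk : ∀ {e g}, (threadGraph E).Reachable e g →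
      (threadGraph E).connectedComponentMk e = (threadGraph E).connectedComponentMk g :=
    fun h => SimpleGraph.ConnectedComponent.sound h
  have hre : ∀ {e g},
      (threadGraph E).connectedComponentMk e = (threadGraph E).connectedComponentMk g →
      (threadGraph E).Reachable e g :=
    fun h => SimpleGraph.ConnectedComponent.exact h
  have hst : ∀ K : (threadGraph E).ConnectedComponent, ∃ s : Sym2 V,
      (∃ e ∈ E, (threadGraph E).connectedComponentMk e = K) →
      IsEndEdge E s ∧ (threadGraph E).connectedComponentMk s = K ∧
      (HasLeafEdge E K → ∃ l ∈ s, edgeDeg E l = 1) ∧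
      (∀ v ∈ A, (threadGraph E).connectedComponentMk (a v) = K →
        ¬ Even ((threadGraph E).dist s (a v))) := by
    intro K
    by_cases hK : ∃ e ∈ E, (threadGraph E).connectedComponentMk e = K
    swap
    · obtain ⟨v, -⟩ := hE.exists_three_le
      exact ⟨s(v, v), fun h => absurd h hK⟩
    by_cases hl : HasLeafEdge E K
    · obtain ⟨g, hg, hgK, l, hlg, hl1⟩ := id hl
      refine ⟨g, fun _ => ⟨⟨hg, l, hlg, by omega⟩, hgK, fun _ => ⟨l, hlg, hl1⟩, ?_⟩⟩
      intro v hv hvK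
      exact absurd (hvK ▸ hl) (hal v hv)
    by_cases hv : ∃ v ∈ A, (threadGraph E).connectedComponentMk (a v) = K
    · obtain ⟨v, hv, hvK⟩ := hv
      have hvend : IsEndEdge E (a v) := ⟨haE v hv, v, hav v hv, by have := hA3 v hv; omega⟩
      obtain ⟨s, hs, hsK, hsv⟩ : ∃ s, IsEndEdge E s ∧ (threadGraph E).connectedComponentMk s = K ∧
          s ≠ a v := by
        have h := hae v hv
        rw [hvK] at h
        by_contra! hno
        refine h (fun g g' hg hg' hgK hgK' => ?_)
        rw [hno g hg hgK, hno g' hg' hgK']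
        simp
      refine ⟨s, fun _ => ⟨hs, hsK, fun h => absurd h hl, ?_⟩⟩
      intro w hw hwK
      obtain rfl := hainj v hv w hw (hre (hvK.trans hwK.symm))
      exact IsBranchedEdgeSet.odd_dist_of_not_isEvenThread (hvK ▸ hae v hv) hs hvend hsK hvK hsv
    · obtain ⟨e, he, heK⟩ := hK
      obtain ⟨g, hg, heg, v, hvg, hv3⟩ := hE.exists_reachable_branch he
      refine ⟨g, fun _ => ⟨⟨hg, v, hvg, by omega⟩, (hmk heg).symm.trans heK,
        fun h => absurd h hl, ?_⟩⟩
      intro w hw hwK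
      exact absurd ⟨w, hw, hwK⟩ hv
  choose st hst using hst
  set ε : (threadGraph E).ConnectedComponent → ℕ := fun K =>
    if K = K₀ ∨ IsPendant E K ∨ (¬ HasLeafEdge E K ∧ IsEvenThread E K) then 0 else 1 with hε
  set cl : (threadGraph E).ConnectedComponent → ℕ := fun K =>
    if K = K₀ then 1 else if IsPendant E K then 0 else
      if ¬ HasLeafEdge E K ∧ IsEvenThread E K then 3 else 2 with hcl
  obtain ⟨π, hπeven, hπdist, hπcl, hπK⟩ := exists_component_keys (threadGraph E) cl ε
    (fun K => by simp only [hε]; split_ifs <;> omega) st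
  have hstE : ∀ e ∈ E, IsEndEdge E (st ((threadGraph E).connectedComponentMk e)) ∧
      (threadGraph E).Reachable (st ((threadGraph E).connectedComponentMk e)) e ∧
      (HasLeafEdge E ((threadGraph E).connectedComponentMk e) →
        ∃ l ∈ st ((threadGraph E).connectedComponentMk e), edgeDeg E l = 1) ∧
      (∀ v ∈ A,
        (threadGraph E).connectedComponentMk (a v) = (threadGraph E).connectedComponentMk e →
        ¬ Even ((threadGraph E).dist (st ((threadGraph E).connectedComponentMk e)) (a v))) := by
    intro e he
    obtain ⟨h1, h2, h3, h4⟩ := hst ((threadGraph E).connectedComponentMk e) ⟨e, he, rfl⟩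
    exact ⟨h1, hre h2, h3, h4⟩
  have hfeq : ∀ v w, 3 ≤ edgeDeg E v → w ∈ f v → 2 ≤ edgeDeg E w → w = v := by
    intro v w hv hw h2
    obtain ⟨-, hfv, l, hl, hl1⟩ := hf v hv
    rcases Sym2.eq_or_eq_or_eq_of_mem hl hw hfv with h | h | h
    · subst h; omega
    · subst h; omega
    · exact h
  have hfno : ∀ v, 3 ≤ edgeDeg E v → ∀ u ∈ f v, edgeDeg E u ≠ 2 := by
    intro v hv
    obtain ⟨-, hfv, l, hl, hl1⟩ := hf v hv
    exact hE.ne_two_of_mem hl hl1 hfv hv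
  -- an edge with a neighbour is not reserved
  have hadjE' : ∀ e g, (threadGraph E).Adj e g → ∀ v, 3 ≤ edgeDeg E v → e ≠ f v := by
    rintro e g ⟨-, -, -, u, hu, hue, -⟩ v hv rfl
    exact hfno v hv u hue hu
  set E' := E.filter (fun e => ∀ v, 3 ≤ edgeDeg E v → e ≠ f v) with hE'def
  have hE' : ∀ e, e ∈ E' ↔ e ∈ E ∧ ∀ v, 3 ≤ edgeDeg E v → e ≠ f v := fun e => by
    rw [hE'def, Finset.mem_filter]
  have hE'E : ∀ e ∈ E', e ∈ E := fun e he => ((hE' e).1 he).1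
  have hpendsing : ∀ e, IsPendant E ((threadGraph E).connectedComponentMk e) →
      ∀ u ∈ e, edgeDeg E u ≠ 2 := by
    rintro e ⟨g, hg, hgK, ⟨l, hl, hl1⟩, v, hv, hv3⟩
    have hno := hE.ne_two_of_mem hl hl1 hv hv3
    rw [← threadGraph_eq_of_reachable hno (hre hgK)]
    exact hno
  have hpendleaf : ∀ K, IsPendant E K → HasLeafEdge E K :=
    fun K ⟨g, hg, hgK, hl, _⟩ => ⟨g, hg, hgK, hl⟩
  have hpendeven : ∀ K, IsPendant E K → IsEvenThread E K :=
    fun K ⟨g, hg, hgK, ⟨l, hl, hl1⟩, v, hv, hv3⟩ =>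
      IsBranchedEdgeSet.isEvenThread_of_no_light hgK (hE.ne_two_of_mem hl hl1 hv hv3)
  -- an even leaf edge is pendant or starts the special thread
  have hevenleaf : ∀ g ∈ E', Even (π g) → (∃ l ∈ g, edgeDeg E l = 1) →
      cl ((threadGraph E).connectedComponentMk g) = 0 ∨
        ((threadGraph E).connectedComponentMk g = K₀ ∧
        (threadGraph E).dist (st ((threadGraph E).connectedComponentMk g)) g = 0) := by
    intro g hg hev hgl
    have hgE := hE'E g hg
    obtain ⟨h1, h2, h3, -⟩ := hstE g hgE
    have hl : HasLeafEdge E ((threadGraph E).connectedComponentMk g) := ⟨g, hgE, rfl, hgl⟩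
    have hsg := hE.leafEdge_eq h1.1 h2 (h3 hl) hgl
    have h0 : (threadGraph E).dist (st ((threadGraph E).connectedComponentMk g)) g = 0 := by
      conv_lhs => rw [hsg]
      simp
    rw [hπeven, h0, add_zero] at hev
    by_cases hK : (threadGraph E).connectedComponentMk g = K₀
    · exact Or.inr ⟨hK, h0⟩
    · refine Or.inl ?_
      by_cases hp : IsPendant E ((threadGraph E).connectedComponentMk g)
      · simp [hcl, hK, hp]
      · simp [hε, hK, hp, hl] at hev
  have hdom : ∀ e ∈ E', 1 ≤ cl ((threadGraph E).connectedComponentMk e) → ∀ g ∈ E', Even (π g) →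
      (∃ l ∈ g, edgeDeg E l = 1) → π g ≤ π e := by
    intro e he h1 g hg hev hgl
    rcases hevenleaf g hg hev hgl with h | ⟨hK, h0⟩
    · have := hπcl g e (by omega)
      omega
    · by_cases heK : (threadGraph E).connectedComponentMk e = K₀
      · have := hπdist e g (heK.trans hK.symm)
        omega
      · have h2 : 1 < cl ((threadGraph E).connectedComponentMk e) := by
          simp only [hcl, if_neg heK] at h1 ⊢
          split_ifs at h1 ⊢ <;> omega
        have h3 : cl ((threadGraph E).connectedComponentMk g) = 1 := by simp [hcl, hK]
        have := hπcl g e (by omega)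
        omega
  have hclpos : ∀ K, (IsPendant E K → K = K₀) → 1 ≤ cl K := by
    intro K h
    simp only [hcl]
    split_ifs with h1 h2 h3
    · exact le_rfl
    · exact absurd (h h2) h1
    · omega
    · omega
  have hlight : ∀ u, edgeDeg E u = 2 → ∀ e ∈ E', ∀ g ∈ E', u ∈ e → u ∈ g → e ≠ g →
      π e = π g + 1 ∨ π g = π e + 1 := by
    intro u hu e he g hg hue hug hne
    have hadj : (threadGraph E).Adj e g := ⟨hne, hE'E e he, hE'E g hg, u, hu, hue, hug⟩
    obtain ⟨h1, h2, -, -⟩ := hstE e (hE'E e he)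
    have h3 := dist_succ_of_adj threadGraph_adj_mem_or h1.adj_unique h2 hadj
    have hK := hmk hadj.reachable
    have h4 := hπdist e g hK
    rw [← hK] at h4
    omega
  refine exists_antimagic_of_layout hE.one_le (fun e he x hx y hy => hE.leaf_eq he hx hy)
    (fun v hv => (hf v hv).1) (fun v hv => (hf v hv).2.1) (fun v hv => (hf v hv).2.2) hE'
    (π := π) ?_ hlight ?_ ?_ ?_
  · intro e he g hg h
    have hK := hπK e g h
    obtain ⟨h1, h2, -, -⟩ := hstE e (hE'E e he)
    have h4 := hπdist e g hK
    rw [← hK] at h4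
    exact dist_injective_of_degree_le_two threadGraph_adj_mem_or h1.adj_unique h2
      (h2.trans (hre hK)) (by omega)
  · intro w hw
    by_cases h3 : 3 ≤ edgeDeg E w
    · rcases hcover w h3 with hwA | ⟨e, he, hwe, hef, hcase⟩
      · have hpend : ¬ IsPendant E ((threadGraph E).connectedComponentMk (a w)) :=
          fun h => hal w hwA (hpendleaf _ h)
        have haw : a w ∈ E' := (hE' _).2 ⟨haE w hwA, fun v hv h => hal w hwA (by
          rw [h]
          exact ⟨f v, (hf v hv).1, rfl, (hf v hv).2.2⟩)⟩
        have hK : (threadGraph E).connectedComponentMk (a w) ≠ K₀ := fun h => hal w hwA (h ▸ hK₀l)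
        refine ⟨a w, haw, hav w hwA, ?_, hdom _ haw (hclpos _ (fun h => absurd h hpend))⟩
        rw [hπeven]
        have h1 : ε ((threadGraph E).connectedComponentMk (a w)) = 1 := by
          simp [hε, hK, hpend, hae w hwA]
        have h2 := (hstE (a w) (haE w hwA)).2.2.2 w hwA rfl
        rw [h1, Nat.even_add]
        exact iff_of_false (by decide) h2
      · have heE' := (hE' e).2 ⟨he, hef⟩
        have heend : IsEndEdge E e := ⟨he, w, hwe, by omega⟩
        obtain ⟨h1, h2, h3', -⟩ := hstE e he
        by_cases hK : (threadGraph E).connectedComponentMk e = K₀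
        · refine ⟨e, heE', hwe, ?_, hdom e heE' (hclpos _ (fun _ => hK))⟩
          rw [hπeven]
          have h4 : ε ((threadGraph E).connectedComponentMk e) = 0 := by simp [hε, hK]
          rw [h4, zero_add]
          exact hK₀e _ _ h1 heend ((hmk h2).trans hK) hK
        · replace hcase := hcase.resolve_left hK
          by_cases hev : IsEvenThread E ((threadGraph E).connectedComponentMk e)
          · have hl := hcase.1 hev
            refine ⟨e, heE', hwe, ?_,
              hdom e heE' (hclpos _ (fun h => absurd (hpendleaf _ h) hl))⟩
            rw [hπeven]
            have h4 : ε ((threadGraph E).connectedComponentMk e) = 0 := by simp [hε, hl, hev]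
            rw [h4, zero_add]
            exact hev _ _ h1 heend (hmk h2) rfl
          · have hl : HasLeafEdge E ((threadGraph E).connectedComponentMk e) := by
              by_contra hl
              exact hev (hcase.2 hl)
            have hpend : ¬ IsPendant E ((threadGraph E).connectedComponentMk e) :=
              fun h => hev (hpendeven _ h)
            refine ⟨e, heE', hwe, ?_, hdom e heE' (hclpos _ (fun h => absurd h hpend))⟩
            rw [hπeven]
            have h4 : ε ((threadGraph E).connectedComponentMk e) = 1 := by simp [hε, hK, hpend, hev]
            have h5 : st ((threadGraph E).connectedComponentMk e) ≠ e := by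
              intro h
              obtain ⟨l, hl, hl1⟩ := h3' hl
              rw [h] at hl
              exact hpend ⟨e, he, rfl, ⟨l, hl, hl1⟩, w, hwe, h3⟩
            have h6 := IsBranchedEdgeSet.odd_dist_of_not_isEvenThread hev h1 heend (hmk h2) rfl h5
            rw [h4, Nat.even_add]
            exact iff_of_false (by decide) h6
    · have hw2 : edgeDeg E w = 2 := by omega
      obtain ⟨e, he, g, hg, hwe, hwg, hne⟩ := exists_edges_of_two_le_edgeDeg hw
      have hadj : (threadGraph E).Adj e g := ⟨hne, he, hg, w, hw2, hwe, hwg⟩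
      have heE' := (hE' e).2 ⟨he, hadjE' e g hadj⟩
      have hgE' := (hE' g).2 ⟨hg, hadjE' g e hadj.symm⟩
      have hpe : ¬ IsPendant E ((threadGraph E).connectedComponentMk e) :=
          fun h => hpendsing e h w hwe hw2
      have hpg : ¬ IsPendant E ((threadGraph E).connectedComponentMk g) :=
          fun h => hpendsing g h w hwg hw2
      have hd := hlight w hw2 e heE' g hgE' hwe hwg hne
      by_cases hev : Even (π e)
      · exact ⟨e, heE', hwe, hev, hdom e heE' (hclpos _ (fun h => absurd h hpe))⟩
      · refine ⟨g, hgE', hwg, ?_, hdom g hgE' (hclpos _ (fun h => absurd h hpg))⟩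
        grind
  · rintro e he hodd ⟨v, hve, hv3⟩ x hx hxev hxl hle
    have heE := hE'E e he
    have hxE := hE'E x hx
    obtain ⟨h1, h2, -, -⟩ := hstE e heE
    have heend : IsEndEdge E e := ⟨heE, v, hve, by omega⟩
    have hcle : cl ((threadGraph E).connectedComponentMk e) ≤ 2 := by
      simp only [hcl]
      split_ifs with c1 c2 c3
      · omega
      · omega
      · exfalso
        rw [hπeven] at hodd
        have h4 : ε ((threadGraph E).connectedComponentMk e) = 0 := by simp [hε, c3]
        rw [h4, zero_add] at hodd
        exact hodd (c3.2 _ _ h1 heend (hmk h2) rfl)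
      · omega
    have hclx : cl ((threadGraph E).connectedComponentMk x) ≤ 2 := by
      by_contra! h
      have := hπcl e x (by omega)
      omega
    obtain ⟨h1x, h2x, h3x, -⟩ := hstE x hxE
    have hx0 : (threadGraph E).dist (st ((threadGraph E).connectedComponentMk x)) x ≠ 0 := by
      intro h0
      have hsx := (h2x.dist_eq_zero_iff).1 h0
      have hnl : ¬ HasLeafEdge E ((threadGraph E).connectedComponentMk x) := by
        intro hl
        obtain ⟨l, hl, hl1⟩ := h3x hl
        rw [hsx] at hl
        exact hxl l hl hl1
      have hK : (threadGraph E).connectedComponentMk x ≠ K₀ := fun h => hnl (h ▸ hK₀l)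
      have hp : ¬ IsPendant E ((threadGraph E).connectedComponentMk x) :=
        fun h => hnl (hpendleaf _ h)
      by_cases hev : IsEvenThread E ((threadGraph E).connectedComponentMk x)
      · simp [hcl, hK, hp, hnl, hev] at hclx
      · rw [hπeven, h0] at hxev
        simp [hε, hK, hp, hev] at hxev
    obtain ⟨y, hyx, hsy, hyd⟩ := exists_adj_dist_eq h2x hx0
    have hyE : y ∈ E := hyx.2.1
    refine ⟨y, (hE' y).2 ⟨hyE, hadjE' y x hyx⟩, ?_⟩
    have hK := hmk hyx.reachable
    have h4 := hπdist y x hK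
    rw [hK] at h4
    omega
  · intro e he hodd
    by_contra! hno
    have heE := hE'E e he
    obtain ⟨-, h2, -, -⟩ := hstE e heE
    have hes := threadGraph_eq_of_reachable hno h2.symm
    have h0 : (threadGraph E).dist (st ((threadGraph E).connectedComponentMk e)) e = 0 := by
      rw [← hes]
      simp
    have hev : IsEvenThread E ((threadGraph E).connectedComponentMk e) :=
      IsBranchedEdgeSet.isEvenThread_of_no_light rfl hno
    rw [hπeven, h0, add_zero] at hodd
    have h5 : ¬ ((threadGraph E).connectedComponentMk e = K₀ ∨
        IsPendant E ((threadGraph E).connectedComponentMk e) ∨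
        (¬ HasLeafEdge E ((threadGraph E).connectedComponentMk e) ∧
          IsEvenThread E ((threadGraph E).connectedComponentMk e))) := by
      intro h
      simp [hε, h] at hodd
    push Not at h5
    have hl : HasLeafEdge E ((threadGraph E).connectedComponentMk e) := by
      by_contra h
      exact h5.2.2 h hev
    obtain ⟨g, hg, hgK, l, hlg, hl1⟩ := hl
    obtain rfl := threadGraph_eq_of_reachable hno (hre hgK.symm)
    exact h5.2.1 ⟨e, hg, rfl, ⟨l, hlg, hl1⟩, hE.exists_branch_mem hg hlg hl1 hno⟩

section BranchVertices

variable {V : Type*} {E : Finset (Sym2 V)}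

/-- A thread meets at most two branch vertices. -/
theorem branch_eq_or_eq_or_eq {p q s : Sym2 V} (hp : p ∈ E) (hq : q ∈ E) (hs : s ∈ E)
    (hpq : (threadGraph E).Reachable p q) (hps : (threadGraph E).Reachable p s) {x y z : V}
    (hxp : x ∈ p) (hyq : y ∈ q) (hzs : z ∈ s) (hx : 3 ≤ edgeDeg E x) (hy : 3 ≤ edgeDeg E y)
    (hz : 3 ≤ edgeDeg E z) : x = y ∨ x = z ∨ y = z := by
  have key : ∀ {p s : Sym2 V} {x y z : V}, (threadGraph E).Reachable p s → x ∈ p → y ∈ p →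
      z ∈ s → 3 ≤ edgeDeg E x → 3 ≤ edgeDeg E y → x = y ∨ x = z ∨ y = z := by
    intro p s x y z hps hxp hyp hzs hx hy
    by_cases hxy : x = y
    · exact Or.inl hxy
    have hno : ∀ u ∈ p, edgeDeg E u ≠ 2 := by
      intro u hu h2
      rcases Sym2.eq_or_eq_or_eq_of_mem hu hxp hyp with h | h | h
      · subst h; omega
      · subst h; omega
      · exact hxy h
    obtain rfl := threadGraph_eq_of_reachable hno hps
    exact Sym2.eq_or_eq_or_eq_of_mem hxp hyp hzs
  rcases IsEndEdge.eq_or_eq_or_eq (a := p) (x := q) (y := s) ⟨hp, x, hxp, by omega⟩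
    ⟨hq, y, hyq, by omega⟩ ⟨hs, z, hzs, by omega⟩ hpq hps with h | h | h
  · subst h
    exact key hps hxp hyq hzs hx hy
  · subst h
    have := key hpq hxp hzs hyq hx hz
    tauto
  · subst h
    have := key hpq.symm hyq hzs hxp hy hz
    tauto

/-- A thread between two branch vertices has no leaf edge. -/
theorem not_hasLeafEdge_of_branch (hE : IsBranchedEdgeSet E) {p q : Sym2 V} (hp : p ∈ E)
    (hq : q ∈ E) (hpq : (threadGraph E).Reachable p q) {x y : V} (hxp : x ∈ p) (hyq : y ∈ q)
    (hx : 3 ≤ edgeDeg E x) (hy : 3 ≤ edgeDeg E y) (hxy : x ≠ y) :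
    ¬ HasLeafEdge E ((threadGraph E).connectedComponentMk p) := by
  rintro ⟨k, hk, hkK, l, hl, hl1⟩
  have hkp := SimpleGraph.ConnectedComponent.exact hkK
  have key : ∀ {p q : Sym2 V} {x y : V}, (threadGraph E).Reachable p q → l ∈ p → x ∈ p → y ∈ q →
      3 ≤ edgeDeg E x → 3 ≤ edgeDeg E y → x = y := by
    intro p q x y hpq hlp hxp hyq hx hy
    obtain rfl := threadGraph_eq_of_reachable (hE.ne_two_of_mem hlp hl1 hxp hx) hpq
    rcases Sym2.eq_or_eq_or_eq_of_mem hxp hyq hlp with h | h | h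
    · exact h
    · subst h; omega
    · subst h; omega
  rcases IsEndEdge.eq_or_eq_or_eq (a := p) (x := q) (y := k) ⟨hp, x, hxp, by omega⟩
    ⟨hq, y, hyq, by omega⟩ ⟨hk, l, hl, by omega⟩ hpq hkp.symm with h | h | h
  · subst h
    have hno : ∀ u ∈ p, edgeDeg E u ≠ 2 := by
      intro u hu h2
      rcases Sym2.eq_or_eq_or_eq_of_mem hu hxp hyq with h | h | h
      · subst h; omega
      · subst h; omega
      · exact hxy h
    obtain rfl := threadGraph_eq_of_reachable hno hkp.symm
    exact hxy (key (SimpleGraph.Reachable.refl _) hl hxp hyq hx hy)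
  · subst h
    exact hxy (key hpq hl hxp hyq hx hy)
  · subst h
    exact hxy (key hpq.symm hl hyq hxp hy hx).symm

/-- Branch vertices are adjacent when some thread meets both. -/
def branchGraph {V : Type*} (E : Finset (Sym2 V)) : SimpleGraph V where
  Adj v w := v ≠ w ∧ 3 ≤ edgeDeg E v ∧ 3 ≤ edgeDeg E w ∧
    ∃ e ∈ E, ∃ g ∈ E, (threadGraph E).Reachable e g ∧ v ∈ e ∧ w ∈ g
  symm := ⟨fun _ _ ⟨h1, h2, h3, e, he, g, hg, h4, h5, h6⟩ =>
    ⟨h1.symm, h3, h2, g, hg, e, he, h4.symm, h6, h5⟩⟩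
  loopless := ⟨fun _ h => h.1 rfl⟩

theorem branchGraph_reachable (hE : IsBranchedEdgeSet E) {r v : V} (hr : 3 ≤ edgeDeg E r)
    (hv : 3 ≤ edgeDeg E v) : (branchGraph E).Reachable r v := by
  have key : ∀ x, 3 ≤ edgeDeg E x → (∃ e ∈ E, ∃ g ∈ E, (threadGraph E).Reachable e g ∧ x ∈ e ∧
      ∃ y ∈ g, 3 ≤ edgeDeg E y ∧ (branchGraph E).Reachable r y) →
      (branchGraph E).Reachable r x := by
    rintro x hx ⟨e, he, g, hg, heg, hxe, y, hyg, hy, hry⟩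
    by_cases hxy : y = x
    · exact hxy ▸ hry
    · exact hry.trans (SimpleGraph.Adj.reachable
        ⟨hxy, hy, hx, g, hg, e, he, heg.symm, hyg, hxe⟩)
  have huniv : {x : V | ∃ e ∈ E, ∃ g ∈ E, (threadGraph E).Reachable e g ∧ x ∈ e ∧
      ∃ y ∈ g, 3 ≤ edgeDeg E y ∧ (branchGraph E).Reachable r y} = Set.univ := by
    refine hE.conn _ ?_ ?_
    · obtain ⟨e, he, g, hg, hre, -⟩ := exists_edges_of_two_le_edgeDeg
          (show 2 ≤ edgeDeg E r by omega)
      exact ⟨r, e, he, e, he, SimpleGraph.Reachable.refl _, hre, r, hre, hr,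
        SimpleGraph.Reachable.refl _⟩
    · rintro k hk x hx y hy hxX
      by_cases h3 : 3 ≤ edgeDeg E x
      · exact ⟨k, hk, k, hk, SimpleGraph.Reachable.refl _, hy, x, hx, h3, key x h3 hxX⟩
      · obtain ⟨e, he, g, hg, heg, hxe, z⟩ := hxX
        have hke : (threadGraph E).Reachable k e := by
          by_cases hke : k = e
          · rw [hke]
          · have h1 := hE.one_le x
            by_cases h2 : edgeDeg E x = 2
            · exact SimpleGraph.Adj.reachable ⟨hke, hk, he, x, h2, hx, hxe⟩
            · exact absurd (eq_of_edgeDeg_eq_one (by omega) hk hx he hxe) hke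
        exact ⟨k, hk, g, hg, hke.trans heg, hy, z⟩
  exact key v hv ((Set.ext_iff.1 huniv v).2 trivial)

end BranchVertices

theorem IsLeafChoice.isEvenThread {V : Type*} {E : Finset (Sym2 V)} (hE : IsBranchedEdgeSet E)
    {f : V → Sym2 V} (hf : IsLeafChoice E f) {v : V} (hv : 3 ≤ edgeDeg E v) :
    IsEvenThread E ((threadGraph E).connectedComponentMk (f v)) := by
  obtain ⟨-, hvf, l, hl, hl1⟩ := hf v hv
  exact IsBranchedEdgeSet.isEvenThread_of_no_light rfl (hE.ne_two_of_mem hl hl1 hvf hv)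

theorem IsLeafChoice.hasLeafEdge {V : Type*} {E : Finset (Sym2 V)}
    {f : V → Sym2 V} (hf : IsLeafChoice E f) {v : V} (hv : 3 ≤ edgeDeg E v) :
    HasLeafEdge E ((threadGraph E).connectedComponentMk (f v)) :=
  ⟨f v, (hf v hv).1, rfl, (hf v hv).2.2⟩

theorem IsBranchedEdgeSet.exists_antimagic_of_root {V : Type*} [Fintype V]
    {E : Finset (Sym2 V)} (hE : IsBranchedEdgeSet E) {f : V → Sym2 V} (hf : IsLeafChoice E f)
    {K₀ : (threadGraph E).ConnectedComponent} (hK₀l : HasLeafEdge E K₀) (hK₀e : IsEvenThread E K₀)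
    {r : V} (hr3 : 3 ≤ edgeDeg E r) {e₀ : Sym2 V} (he₀ : e₀ ∈ E) (hre₀ : r ∈ e₀)
    (he₀f : ∀ w, 3 ≤ edgeDeg E w → e₀ ≠ f w)
    (hcase : (threadGraph E).connectedComponentMk e₀ = K₀ ∨
      (IsEvenThread E ((threadGraph E).connectedComponentMk e₀) ↔
        ¬ HasLeafEdge E ((threadGraph E).connectedComponentMk e₀))) :
    ∃ φ : Sym2 V → ℕ, Set.BijOn φ ↑E ↑(Finset.Icc 1 E.card) ∧
      Function.Injective (fun v : V => ∑ e ∈ E.filter (fun e => v ∈ e), φ e) := by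
  have hpred : ∀ v, ∃ e : Sym2 V, ∃ v' : V, ∃ g : Sym2 V, 3 ≤ edgeDeg E v ∧ v ≠ r →
      e ∈ E ∧ g ∈ E ∧ (threadGraph E).Reachable e g ∧ v ∈ e ∧ v' ∈ g ∧ 3 ≤ edgeDeg E v' ∧
        (branchGraph E).dist r v' + 1 = (branchGraph E).dist r v := by
    intro v
    by_cases hv : 3 ≤ edgeDeg E v ∧ v ≠ r
    · have hreach := branchGraph_reachable hE hr3 hv.1
      obtain ⟨v', ⟨-, h3, -, g, hg, e, he, hge, hv'g, hve⟩, -, hd⟩ :=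
        exists_adj_dist_eq hreach (hreach.pos_dist_of_ne hv.2.symm).ne'
      exact ⟨e, v', g, fun _ => ⟨he, hg, hge.symm, hve, hv'g, h3, hd⟩⟩
    · exact ⟨e₀, v, e₀, fun h => absurd h hv⟩
  choose a p g hpred using hpred
  have hne : ∀ v, 3 ≤ edgeDeg E v ∧ v ≠ r → v ≠ p v := by
    intro v hv h
    have := (hpred v hv).2.2.2.2.2.2
    rw [← h] at this
    omega
  have hnl : ∀ v, 3 ≤ edgeDeg E v ∧ v ≠ r →
      ¬ HasLeafEdge E ((threadGraph E).connectedComponentMk (a v)) := by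
    intro v hv
    obtain ⟨h1, h2, h3, h4, h5, h6, h7⟩ := hpred v hv
    exact not_hasLeafEdge_of_branch hE h1 h2 h3 h4 h5 hv.1 h6 (hne v hv)
  refine hE.exists_antimagic_of_assignment hf hK₀l hK₀e
    (A := {v | (3 ≤ edgeDeg E v ∧ v ≠ r) ∧
      ¬ IsEvenThread E ((threadGraph E).connectedComponentMk (a v))}) (a := a)
    (fun v hv => (hpred v hv.1).1) (fun v hv => (hpred v hv.1).2.2.2.1) (fun v hv => hv.1.1)
    (fun v hv => hnl v hv.1) (fun v hv => hv.2) ?_ ?_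
  · rintro v ⟨hv, -⟩ w ⟨hw, -⟩ hvw
    obtain ⟨h1, h2, h3, h4, h5, h6, h7⟩ := hpred v hv
    obtain ⟨k1, k2, k3, k4, k5, k6, k7⟩ := hpred w hw
    have hw' := branch_eq_or_eq_or_eq h1 h2 k1 h3 hvw h4 h5 k4 hv.1 h6 hw.1
    have hp' := branch_eq_or_eq_or_eq h1 h2 k2 h3 (hvw.trans k3) h4 h5 k5 hv.1 h6 k6
    rcases hw' with h | h | h
    · exact absurd h (hne v hv)
    · exact h
    · exfalso
      rcases hp' with h' | h' | h'
      · exact hne v hv h'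
      · rw [← h'] at k7; rw [← h] at k7; omega
      · rw [← h', ← h] at k7; omega
  · intro v hv3
    by_cases hvr : v = r
    · subst hvr
      exact Or.inr ⟨e₀, he₀, hre₀, he₀f, hcase⟩
    by_cases hev : IsEvenThread E ((threadGraph E).connectedComponentMk (a v))
    · have h := hnl v ⟨hv3, hvr⟩
      obtain ⟨h1, h2, h3, h4, h5, h6, h7⟩ := hpred v ⟨hv3, hvr⟩
      exact Or.inr ⟨a v, h1, h4, fun w hw he => h (he ▸ hf.hasLeafEdge hw),
        Or.inr ⟨fun _ => h, fun _ => hev⟩⟩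
    · exact Or.inl ⟨⟨hv3, hvr⟩, hev⟩

theorem IsBranchedEdgeSet.exists_antimagic {V : Type*} [Fintype V]
    {E : Finset (Sym2 V)} (hE : IsBranchedEdgeSet E) {f : V → Sym2 V} (hf : IsLeafChoice E f) :
    ∃ φ : Sym2 V → ℕ, Set.BijOn φ ↑E ↑(Finset.Icc 1 E.card) ∧
      Function.Injective (fun v : V => ∑ e ∈ E.filter (fun e => v ∈ e), φ e) := by
  by_cases hroot : ∃ K₀ : (threadGraph E).ConnectedComponent, HasLeafEdge E K₀ ∧
      IsEvenThread E K₀ ∧ ∃ r, 3 ≤ edgeDeg E r ∧ ∃ e₀ ∈ E, r ∈ e₀ ∧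
      (∀ w, 3 ≤ edgeDeg E w → e₀ ≠ f w) ∧ ((threadGraph E).connectedComponentMk e₀ = K₀ ∨
      (IsEvenThread E ((threadGraph E).connectedComponentMk e₀) ↔
        ¬ HasLeafEdge E ((threadGraph E).connectedComponentMk e₀)))
  · obtain ⟨K₀, hl, he, r, hr, e₀, he₀, hre, hef, hc⟩ := hroot
    exact hE.exists_antimagic_of_root hf hl he hr he₀ hre hef hc
  push Not at hroot
  obtain ⟨v₀, hv₀⟩ := hE.exists_three_le
  have hl₀ := hf.hasLeafEdge hv₀
  have he₀ := IsLeafChoice.isEvenThread hE hf hv₀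
  have hodd : ∀ r, 3 ≤ edgeDeg E r → ∀ e ∈ E, r ∈ e → (∀ w, 3 ≤ edgeDeg E w → e ≠ f w) →
      ¬ IsEvenThread E ((threadGraph E).connectedComponentMk e) ∧
        ¬ HasLeafEdge E ((threadGraph E).connectedComponentMk e) := by
    intro r hr e he hre hef
    have h1 := (hroot _ hl₀ he₀ r hr e he hre hef).2
    by_cases hl : HasLeafEdge E ((threadGraph E).connectedComponentMk e)
    · by_cases hev : IsEvenThread E ((threadGraph E).connectedComponentMk e)
      · exact absurd rfl (hroot _ hl hev r hr e he hre hef).1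
      · tauto
    · tauto
  set E' := E.filter (fun e => ∀ w, 3 ≤ edgeDeg E w → e ≠ f w) with hE'
  have memE' : ∀ e, e ∈ E' ↔ e ∈ E ∧ ∀ w, 3 ≤ edgeDeg E w → e ≠ f w := fun e => by
    rw [hE', Finset.mem_filter]
  have htwo : ∀ v, 3 ≤ edgeDeg E v → 2 ≤ (E'.filter (fun e => v ∈ e)).card := by
    intro v hv
    have hsub : (E.filter (fun e => v ∈ e)).erase (f v) ⊆ E'.filter (fun e => v ∈ e) := by
      intro e he
      rw [Finset.mem_erase, Finset.mem_filter] at he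
      refine Finset.mem_filter.2 ⟨(memE' e).2 ⟨he.2.1, fun w hw hew => ?_⟩, he.2.2⟩
      obtain ⟨-, hwf, l, hl, hl1⟩ := hf w hw
      rcases Sym2.eq_or_eq_or_eq_of_mem (hew ▸ he.2.2) hwf hl with h | h | h
      · subst h; exact he.1 hew
      · subst h; omega
      · subst h; omega
    have h1 := Finset.card_le_card hsub
    have h2 := Finset.pred_card_le_card_erase (a := f v) (s := E.filter (fun e => v ∈ e))
    have h3 : 3 ≤ (E.filter (fun e => v ∈ e)).card := hv
    omega
  obtain ⟨K, hKinj, hK⟩ := (Finset.all_card_le_biUnion_card_iff_exists_injective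
    (fun v : {v : V // 3 ≤ edgeDeg E v} => (E'.filter (fun e => v.1 ∈ e)).image
      (threadGraph E).connectedComponentMk)).1 (by
    intro s
    set P := s.biUnion (fun v => E'.filter (fun e => v.1 ∈ e)) with hP
    have hPcard : 2 * s.card ≤ P.card := by
      rw [hP, Finset.card_biUnion, mul_comm]
      · exact Finset.card_nsmul_le_sum s _ 2 (fun v _ => htwo v.1 v.2)
      · intro v _ w _ hvw
        rw [Function.onFun, Finset.disjoint_left]
        intro e hev hew
        rw [Finset.mem_filter] at hev hew
        have heE := (memE' e).1 hev.1
        refine (hodd v.1 v.2 e heE.1 hev.2 heE.2).1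
          (IsBranchedEdgeSet.isEvenThread_of_no_light rfl (fun u hu h2 => ?_))
        have hv := v.2
        have hw := w.2
        rcases Sym2.eq_or_eq_or_eq_of_mem hu hev.2 hew.2 with h | h | h
        · rw [← h] at hv; omega
        · rw [← h] at hw; omega
        · exact hvw (Subtype.ext h)
    have himage : P.image (threadGraph E).connectedComponentMk = s.biUnion
        (fun v => (E'.filter (fun e => v.1 ∈ e)).image (threadGraph E).connectedComponentMk) := by
      rw [hP, Finset.biUnion_image]
    have hend : ∀ e ∈ P, IsEndEdge E e := by
      intro e he
      obtain ⟨v, -, hv⟩ := Finset.mem_biUnion.1 he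
      rw [Finset.mem_filter] at hv
      exact ⟨((memE' e).1 hv.1).1, v.1, hv.2, by have := v.2; omega⟩
    have hfib := Finset.card_le_mul_card_image (f := (threadGraph E).connectedComponentMk) P 2 (by
      intro K _
      by_contra! hlt
      obtain ⟨x, hx, y, hy, z, hz, hxy, hxz, hyz⟩ := Finset.two_lt_card.1 hlt
      rw [Finset.mem_filter] at hx hy hz
      rcases IsEndEdge.eq_or_eq_or_eq (hend x hx.1) (hend y hy.1) (hend z hz.1)
        (SimpleGraph.ConnectedComponent.exact (hx.2.trans hy.2.symm))
        (SimpleGraph.ConnectedComponent.exact (hx.2.trans hz.2.symm)) with h | h | h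
      · exact hxy h
      · exact hxz h
      · exact hyz h)
    rw [← himage]
    omega)
  have hK' : ∀ v : V, ∃ e, 3 ≤ edgeDeg E v → e ∈ E' ∧ v ∈ e ∧ ∀ h : 3 ≤ edgeDeg E v,
      (threadGraph E).connectedComponentMk e = K ⟨v, h⟩ := by
    intro v
    by_cases hv : 3 ≤ edgeDeg E v
    · obtain ⟨e, he, heK⟩ := Finset.mem_image.1 (hK ⟨v, hv⟩)
      rw [Finset.mem_filter] at he
      exact ⟨e, fun _ => ⟨he.1, he.2, fun _ => heK⟩⟩
    · exact ⟨f v, fun h => absurd h hv⟩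
  choose a ha using hK'
  have haE : ∀ v, 3 ≤ edgeDeg E v → a v ∈ E := fun v hv => ((memE' _).1 (ha v hv).1).1
  have hodd' := fun v hv => hodd v hv (a v) (haE v hv) (ha v hv).2.1 ((memE' _).1 (ha v hv).1).2
  refine hE.exists_antimagic_of_assignment hf hl₀ he₀ (A := {v | 3 ≤ edgeDeg E v}) (a := a)
    haE (fun v hv => (ha v hv).2.1) (fun v hv => hv) (fun v hv => (hodd' v hv).2)
    (fun v hv => (hodd' v hv).1) ?_ (fun v hv => Or.inl hv)
  intro v hv w hw hvw
  have h := SimpleGraph.ConnectedComponent.sound hvw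
  have h2 := hKinj (((ha v hv).2.2 hv).symm.trans (h.trans ((ha w hw).2.2 hw)))
  exact congrArg Subtype.val h2

section MaxDegreeTwo

variable {V : Type*} {E : Finset (Sym2 V)}

/-- In a connected graph of maximum degree two with a vertex `x` that is a leaf if there is one,
every edge is reached from an edge at `x` without passing through `x`. -/
theorem edgeGraphAt_reachable_of_edgeDeg_le_two [Finite V] (hdiag : ∀ e ∈ E, ¬ e.IsDiag)
    (hdeg : ∀ v, 1 ≤ edgeDeg E v ∧ edgeDeg E v ≤ 2)
    (hconn : ∀ X : Set V, X.Nonempty → (∀ e ∈ E, ∀ x ∈ e, ∀ y ∈ e, x ∈ X → y ∈ X) →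
      X = Set.univ) {x : V} (hx : edgeDeg E x = 1 ∨ ∀ v, edgeDeg E v = 2) {e₀ : Sym2 V}
    (he₀ : e₀ ∈ E) (hxe₀ : x ∈ e₀) {k : Sym2 V} (hk : k ∈ E) :
    (edgeGraphAt E {u | edgeDeg E u = 2 ∧ u ≠ x}).Reachable e₀ k := by
  set L : Set V := {u | edgeDeg E u = 2 ∧ u ≠ x} with hLdef
  have hL : ∀ u ∈ L, edgeDeg E u ≤ 2 := fun u hu => hu.1.le
  have hxL : x ∉ L := fun h => h.2 rfl
  have hxedge : ∀ k ∈ E, x ∈ k → (edgeGraphAt E L).Reachable e₀ k := by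
    intro k hk hxk
    rcases hx with h1 | hall
    · rw [eq_of_edgeDeg_eq_one h1 hk hxk he₀ hxe₀]
    obtain ⟨z, hz, hmax⟩ := Set.exists_max_image {z | (edgeGraphAt E L).Reachable e₀ z}
      ((edgeGraphAt E L).dist e₀) (Set.toFinite _) ⟨e₀, SimpleGraph.Reachable.refl _⟩
    have hzE := edgeGraphAt_mem_of_reachable he₀ hz
    have hadj : ∀ u, u ≠ x → ∀ e ∈ E, u ∈ e → ∃ g, (edgeGraphAt E L).Adj e g ∧ u ∈ g := by
      intro u hu e he hue
      obtain ⟨g, hg, hug, hge⟩ := exists_edge_ne_of_two_le_edgeDeg (hall u).ge e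
      exact ⟨g, ⟨hge.symm, he, hg, u, ⟨hall u, hu⟩, hue, hug⟩, hug⟩
    have hz0 : (edgeGraphAt E L).dist e₀ z ≠ 0 := by
      obtain ⟨u, hu, hux⟩ := Sym2.exists_mem_ne (hdiag e₀ he₀) hxe₀
      obtain ⟨g, hg, -⟩ := hadj u hux e₀ he₀ hu
      have h1 := hmax g hg.reachable
      have h2 := hg.reachable.pos_dist_of_ne hg.ne
      omega
    have hu1 := fun g₁ g₂ => edgeGraphAt_adj_unique (g₁ := g₁) (g₂ := g₂) hL hxe₀ hxL
    obtain ⟨p, hpz, hp, hpd⟩ := exists_adj_dist_eq hz hz0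
    obtain ⟨hpne, hpE, -, u, hu, hup, huz⟩ := id hpz
    obtain ⟨u', hu', hne⟩ := Sym2.exists_mem_ne (hdiag z hzE) huz
    have hxz : x ∈ z := by
      by_contra hxz
      obtain ⟨g, hzg, hug⟩ := hadj u' (fun h => hxz (h ▸ hu')) z hzE hu'
      rcases dist_succ_of_adj (fun _ _ _ _ => edgeGraphAt_adj_mem_or hL) hu1 hz hzg with h | h
      · have := hmax g (hz.trans hzg.reachable)
        omega
      · have hpg : p = g := dist_injective_of_degree_le_two
          (fun _ _ _ _ => edgeGraphAt_adj_mem_or hL) hu1 hp (hz.trans hzg.reachable) (by omega)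
        subst hpg
        exact hpne (Sym2.eq_of_two_common hne hug hup hu' huz)
    have hez : e₀ ≠ z := fun h => hz0 (by rw [h]; simp)
    rcases eq_or_eq_of_edgeDeg_le_two (hdeg x).2 he₀ hxe₀ hzE hxz hk hxk with h | h | h
    · exact absurd h hez
    · rw [h]
    · exact h ▸ hz
  have hcover := edgeGraphAt_cover_eq_univ (L := L) hconn he₀ (by
    intro g hg y hyg hyL k hk hyk
    by_cases hyx : y = x
    · exact hxedge k hk (hyx ▸ hyk)
    · have h1 : edgeDeg E y ≠ 2 := fun h => hyL ⟨h, hyx⟩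
      have h2 := hdeg y
      rwa [eq_of_edgeDeg_eq_one (by omega) hk hyk (edgeGraphAt_mem_of_reachable he₀ hg) hyg])
  induction k with
  | _ y y' =>
    obtain ⟨g, hg, hyg⟩ := hcover y
    have hyk := Sym2.mem_mk_left y y'
    by_cases hgk : g = s(y, y')
    · exact hgk ▸ hg
    have hgE := edgeGraphAt_mem_of_reachable he₀ hg
    by_cases hyx : y = x
    · exact hxedge _ hk (hyx ▸ hyk)
    by_cases h2 : edgeDeg E y = 2
    · exact hg.trans (SimpleGraph.Adj.reachable ⟨hgk, hgE, hk, y, ⟨h2, hyx⟩, hyg, hyk⟩)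
    · have := hdeg y
      exact absurd (eq_of_edgeDeg_eq_one (by omega) hgE hyg hk hyk) hgk

/-- The edges of a path or a cycle in order, starting from a vertex `x`. -/
theorem exists_edge_positions [Finite V] (hdiag : ∀ e ∈ E, ¬ e.IsDiag)
    (hdeg : ∀ v, 1 ≤ edgeDeg E v ∧ edgeDeg E v ≤ 2)
    (hconn : ∀ X : Set V, X.Nonempty → (∀ e ∈ E, ∀ x ∈ e, ∀ y ∈ e, x ∈ X → y ∈ X) →
      X = Set.univ) (hcard : 2 ≤ E.card) {x : V}
    (hx : edgeDeg E x = 1 ∨ ∀ v, edgeDeg E v = 2) :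
    ∃ pos : Sym2 V → ℕ, Set.BijOn pos ↑E ↑(Finset.range E.card) ∧
      (∃ e ∈ E, x ∈ e ∧ pos e = 0) ∧
      (∀ u, u ≠ x → edgeDeg E u = 2 → ∀ e ∈ E, ∀ g ∈ E, u ∈ e → u ∈ g → e ≠ g →
        pos e = pos g + 1 ∨ pos g = pos e + 1) ∧
      (∀ g ∈ E, x ∈ g → pos g = 0 ∨ pos g + 1 = E.card) ∧
      (∀ y, y ≠ x → edgeDeg E y = 1 → ∀ g ∈ E, y ∈ g → pos g + 1 = E.card) := by
  obtain ⟨e₀, he₀⟩ := Finset.card_pos.1 (show 0 < (E.filter (x ∈ ·)).card from (hdeg x).1)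
  rw [Finset.mem_filter] at he₀
  obtain ⟨he₀, hxe₀⟩ := he₀
  have hreach : ∀ k ∈ E, (edgeGraphAt E {u | edgeDeg E u = 2 ∧ u ≠ x}).Reachable e₀ k :=
    fun k hk => edgeGraphAt_reachable_of_edgeDeg_le_two hdiag hdeg hconn hx he₀ hxe₀ hk
  set L : Set V := {u | edgeDeg E u = 2 ∧ u ≠ x} with hLdef
  have hL : ∀ u ∈ L, edgeDeg E u ≤ 2 := fun u hu => hu.1.le
  have hu1 : ∀ {e : Sym2 V} {w : V}, w ∈ e → w ∉ L → ∀ g₁ g₂, (edgeGraphAt E L).Adj e g₁ →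
      (edgeGraphAt E L).Adj e g₂ → g₁ = g₂ :=
    fun hw hwL g₁ g₂ => edgeGraphAt_adj_unique hL hw hwL
  have hu2 : ∀ e g₁ g₂ g₃, (edgeGraphAt E L).Adj e g₁ → (edgeGraphAt E L).Adj e g₂ →
      (edgeGraphAt E L).Adj e g₃ → g₁ = g₂ ∨ g₁ = g₃ ∨ g₂ = g₃ :=
    fun _ _ _ _ => edgeGraphAt_adj_mem_or hL
  have hxL : x ∉ L := fun h => h.2 rfl
  set pos : Sym2 V → ℕ := (edgeGraphAt E L).dist e₀ with hpos
  have hinj : Set.InjOn pos E := fun e he g hg h =>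
    dist_injective_of_degree_le_two hu2 (hu1 hxe₀ hxL) (hreach e he) (hreach g hg) h
  have hsub : E.image pos ⊆ Finset.range E.card := by
    intro n hn
    obtain ⟨e, he, rfl⟩ := Finset.mem_image.1 hn
    have h1 : Finset.range (pos e + 1) ⊆ E.image pos := by
      intro i hi
      obtain ⟨y, hy, hyi⟩ := exists_reachable_dist_eq (n := i) (hreach e he)
        (Nat.lt_succ_iff.1 (Finset.mem_range.1 hi))
      exact Finset.mem_image.2 ⟨y, edgeGraphAt_mem_of_reachable he₀ hy, hyi⟩
    have h2 := Finset.card_le_card h1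
    rw [Finset.card_range, Finset.card_image_of_injOn hinj] at h2
    exact Finset.mem_range.2 h2
  have himage : E.image pos = Finset.range E.card :=
    Finset.eq_of_subset_of_card_le hsub (by
      rw [Finset.card_range, Finset.card_image_of_injOn hinj])
  have hbij : Set.BijOn pos ↑E ↑(Finset.range E.card) := by
    rw [← himage, Finset.coe_image]
    exact hinj.bijOn_image
  have hlast : ∀ g ∈ E, e₀ ≠ g → ∀ y ∈ g, y ∉ L → pos g + 1 = E.card := by
    intro g hg hne y hy hyL
    obtain ⟨k, hk, hkpos⟩ := hbij.surjOn (show E.card - 1 ∈ _ by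
      rw [Finset.mem_coe, Finset.mem_range]; omega)
    have h1 : pos k ≤ pos g := dist_le_of_degree_le_one hu2 (hu1 hxe₀ hxL) (hreach g hg)
      (hreach k hk) hne (hu1 hy hyL)
    have h2 := Finset.mem_range.1 (hbij.mapsTo hg)
    omega
  refine ⟨pos, hbij, ⟨e₀, he₀, hxe₀, by simp [hpos]⟩, ?_, ?_, ?_⟩
  · intro u hux hu e he g hg hue hug hne
    have hadj : (edgeGraphAt E L).Adj e g := ⟨hne, he, hg, u, ⟨hu, hux⟩, hue, hug⟩
    have := dist_succ_of_adj hu2 (hu1 hxe₀ hxL) (hreach e he) hadj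
    simp only [hpos]
    omega
  · intro g hg hxg
    by_cases h : e₀ = g
    · subst h
      exact Or.inl (by simp [hpos])
    · exact Or.inr (hlast g hg h x hxg hxL)
  · intro y hyx hy1 g hg hyg
    have hyL : y ∉ L := fun h => by have := h.1; omega
    refine hlast g hg (fun h => ?_) y hyg hyL
    subst h
    have hno : ∀ u ∈ e₀, u ∉ L := by
      intro u hu huL
      rcases Sym2.eq_or_eq_or_eq_of_mem hu hyg hxe₀ with h | h | h
      · exact hyL (h ▸ huL)
      · exact hxL (h ▸ huL)
      · exact hyx h
    have : E.card ≤ 1 := Finset.card_le_one.2 (fun a ha b hb =>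
      (edgeGraphAt_eq_of_reachable hno (hreach a ha)).symm.trans
        (edgeGraphAt_eq_of_reachable hno (hreach b hb)))
    omega

/-- The labels `1, 2, …, m` in order, with the last two possibly swapped, keep the sum of the last
label and `c` distinct from all sums of consecutive labels. -/
theorem exists_consecutive_labels {m c : ℕ} (hm : 3 ≤ m) (hc : c ≤ 1) :
    ∃ F : ℕ → ℕ, Set.BijOn F ↑(Finset.range m) ↑(Finset.Icc 1 m) ∧ F 0 = 1 ∧ 2 ≤ F (m - 1) ∧
      (∀ i j, i < j → j + 1 < m → F i + F (i + 1) < F j + F (j + 1)) ∧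
      (∀ i, i + 1 < m → 1 < F i + F (i + 1)) ∧
      (∀ i, i + 1 < m → F i + F (i + 1) ≠ c + F (m - 1)) := by
  have hb : ∀ F : ℕ → ℕ, (∀ i < m, 1 ≤ F i ∧ F i ≤ m) →
      (∀ i < m, ∀ j < m, F i = F j → i = j) →
      Set.BijOn F ↑(Finset.range m) ↑(Finset.Icc 1 m) := by
    intro F h1 h2
    have hmaps : ∀ i ∈ Finset.range m, F i ∈ Finset.Icc 1 m := fun i hi =>
      Finset.mem_Icc.2 (h1 i (Finset.mem_range.1 hi))
    have hinj : Set.InjOn F ↑(Finset.range m) := fun i hi j hj h =>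
      h2 i (Finset.mem_range.1 hi) j (Finset.mem_range.1 hj) h
    exact ⟨hmaps, hinj, Finset.surjOn_of_injOn_of_card_le F hmaps hinj (by simp)⟩
  by_cases hpar : Even (c + m)
  · refine ⟨fun i => i + 1, hb _ (fun i hi => by omega) (fun i hi j hj h => by omega), ?_⟩
    refine ⟨rfl, by simp only; omega, fun i j _ _ => by simp only; omega,
      fun i _ => by simp only; omega, fun i _ h => ?_⟩
    obtain ⟨t, ht⟩ := hpar
    simp only at h
    omega
  · refine ⟨fun i => if i + 2 = m then m else if i + 1 = m then m - 1 else i + 1,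
      hb _ (fun i hi => by split_ifs <;> omega)
        (fun i hi j hj h => by split_ifs at h <;> omega), ?_⟩
    rw [Nat.not_even_iff_odd] at hpar
    obtain ⟨t, ht⟩ := hpar
    refine ⟨by simp only; split_ifs <;> omega, by simp only; split_ifs <;> omega,
      fun i j _ _ => by simp only; split_ifs <;> omega,
      fun i _ => by simp only; split_ifs <;> omega,
      fun i _ h => ?_⟩
    simp only at h
    split_ifs at h <;> omega

theorem exists_antimagic_of_edgeDeg_le_two [Finite V] (hdiag : ∀ e ∈ E, ¬ e.IsDiag)
    (hdeg : ∀ v, 1 ≤ edgeDeg E v ∧ edgeDeg E v ≤ 2)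
    (hconn : ∀ X : Set V, X.Nonempty → (∀ e ∈ E, ∀ x ∈ e, ∀ y ∈ e, x ∈ X → y ∈ X) →
      X = Set.univ) (hcard : 3 ≤ E.card) :
    ∃ φ : Sym2 V → ℕ, Set.BijOn φ ↑E ↑(Finset.Icc 1 E.card) ∧
      Function.Injective (fun v : V => ∑ e ∈ E.filter (fun e => v ∈ e), φ e) := by
  obtain ⟨x, hx⟩ : ∃ x, edgeDeg E x = 1 ∨ ∀ v, edgeDeg E v = 2 := by
    by_cases h : ∃ x, edgeDeg E x = 1
    · obtain ⟨x, hx⟩ := h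
      exact ⟨x, Or.inl hx⟩
    · push Not at h
      obtain ⟨e, he⟩ := Finset.card_pos.1 (show 0 < E.card by omega)
      induction e with
      | _ a b =>
        refine ⟨a, Or.inr (fun v => ?_)⟩
        have h1 := hdeg v
        have h2 := h v
        omega
  obtain ⟨pos, hpos, ⟨e₀, he₀, hxe₀, hpos0⟩, hcons, hxpos, hend⟩ :=
    exists_edge_positions hdiag hdeg hconn (by omega) hx
  obtain ⟨F, hF, hF0, hF2, hFmono, hF1, hFne⟩ := exists_consecutive_labels (m := E.card)
    (c := edgeDeg E x - 1) hcard (by have := (hdeg x).2; omega)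
  have hbij : Set.BijOn (F ∘ pos) ↑E ↑(Finset.Icc 1 E.card) := hF.comp hpos
  have hmid : ∀ u, u ≠ x → edgeDeg E u = 2 → ∃ i, i + 1 < E.card ∧
      (∃ e ∈ E, ∃ g ∈ E, u ∈ e ∧ u ∈ g ∧ pos e = i ∧ pos g = i + 1) ∧
      ∑ e ∈ E.filter (fun e => u ∈ e), (F ∘ pos) e = F i + F (i + 1) := by
    intro u hux hu
    obtain ⟨e, g, hne, heg⟩ := Finset.card_eq_two.1 (show (E.filter (u ∈ ·)).card = 2 from hu)
    have he : e ∈ E.filter (u ∈ ·) := by rw [heg]; simp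
    have hg : g ∈ E.filter (u ∈ ·) := by rw [heg]; simp
    rw [Finset.mem_filter] at he hg
    have hpe := Finset.mem_range.1 (hpos.mapsTo he.1)
    have hpg := Finset.mem_range.1 (hpos.mapsTo hg.1)
    rcases hcons u hux hu e he.1 g hg.1 he.2 hg.2 hne with h | h
    · refine ⟨pos g, by omega, ⟨g, hg.1, e, he.1, hg.2, he.2, rfl, h⟩, ?_⟩
      rw [heg, Finset.sum_pair hne, Function.comp_apply, Function.comp_apply, h, add_comm]
    · refine ⟨pos e, by omega, ⟨e, he.1, g, hg.1, he.2, hg.2, rfl, h⟩, ?_⟩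
      rw [heg, Finset.sum_pair hne, Function.comp_apply, Function.comp_apply, h]
  have hmidinj : ∀ u w, u ≠ x → w ≠ x → edgeDeg E u = 2 → edgeDeg E w = 2 →
      ∑ e ∈ E.filter (fun e => u ∈ e), (F ∘ pos) e =
        ∑ e ∈ E.filter (fun e => w ∈ e), (F ∘ pos) e → u = w := by
    intro u w hux hwx hu hw h
    obtain ⟨i, hi, ⟨e, he, g, hg, hue, hug, hei, hgi⟩, hsi⟩ := hmid u hux hu
    obtain ⟨j, hj, ⟨e', he', g', hg', hwe, hwg, hej, hgj⟩, hsj⟩ := hmid w hwx hw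
    have hij : i = j := by
      rcases lt_trichotomy i j with h' | h' | h'
      · have := hFmono i j h' hj; omega
      · exact h'
      · have := hFmono j i h' hi; omega
    subst hij
    obtain rfl := hpos.injOn he he' (hei.trans hej.symm)
    obtain rfl := hpos.injOn hg hg' (hgi.trans hgj.symm)
    by_contra huw
    have := Sym2.eq_of_two_common huw hue hwe hug hwg
    subst this
    omega
  have hone : ∀ y, edgeDeg E y = 1 → ∃ e ∈ E, y ∈ e ∧
      ∑ e ∈ E.filter (fun e => y ∈ e), (F ∘ pos) e = F (pos e) := by
    intro y hy
    obtain ⟨e, he⟩ := Finset.card_eq_one.1 (show (E.filter (y ∈ ·)).card = 1 from hy)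
    have hm : e ∈ E.filter (y ∈ ·) := by rw [he]; simp
    rw [Finset.mem_filter] at hm
    exact ⟨e, hm.1, hm.2, by rw [he, Finset.sum_singleton]; rfl⟩
  refine ⟨F ∘ pos, hbij, fun v w hvw => ?_⟩
  simp only at hvw
  rcases hx with hx1 | hall
  · have hxsum : ∑ e ∈ E.filter (fun e => x ∈ e), (F ∘ pos) e = 1 := by
      obtain ⟨e, he, hxe, hs⟩ := hone x hx1
      obtain rfl := eq_of_edgeDeg_eq_one hx1 he hxe he₀ hxe₀
      rw [hs, hpos0, hF0]
    have hleaf : ∀ y, y ≠ x → edgeDeg E y = 1 → ∃ e ∈ E, y ∈ e ∧ pos e + 1 = E.card ∧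
        ∑ e ∈ E.filter (fun e => y ∈ e), (F ∘ pos) e = F (E.card - 1) := by
      intro y hyx hy
      obtain ⟨e, he, hye, hs⟩ := hone y hy
      have hp := hend y hyx hy e he hye
      exact ⟨e, he, hye, hp, by rw [hs, ← hp]; rfl⟩
    have hxother : ∀ y, y ≠ x →
        1 < ∑ e ∈ E.filter (fun e => y ∈ e), (F ∘ pos) e := by
      intro y hyx
      by_cases hy : edgeDeg E y = 1
      · obtain ⟨e, -, -, -, hs⟩ := hleaf y hyx hy
        omega
      · obtain ⟨i, hi, -, hs⟩ := hmid y hyx (by have := hdeg y; omega)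
        have := hF1 i hi
        omega
    have hleafmid : ∀ y u, y ≠ x → u ≠ x → edgeDeg E y = 1 → edgeDeg E u = 2 →
        ∑ e ∈ E.filter (fun e => y ∈ e), (F ∘ pos) e ≠
          ∑ e ∈ E.filter (fun e => u ∈ e), (F ∘ pos) e := by
      intro y u hyx hux hy hu h
      obtain ⟨e, -, -, -, hs⟩ := hleaf y hyx hy
      obtain ⟨i, hi, -, hs'⟩ := hmid u hux hu
      have := hFne i hi
      rw [hx1] at this
      omega
    by_cases hvx : v = x <;> by_cases hwx : w = x
    · rw [hvx, hwx]
    · have := hxother w hwx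
      rw [hvx] at hvw
      omega
    · have := hxother v hvx
      rw [hwx] at hvw
      omega
    · have hv := hdeg v
      have hw := hdeg w
      by_cases h1 : edgeDeg E v = 1 <;> by_cases h2 : edgeDeg E w = 1
      · obtain ⟨e, he, hve, hpe, -⟩ := hleaf v hvx h1
        obtain ⟨g, hg, hwg, hpg, -⟩ := hleaf w hwx h2
        obtain rfl := hpos.injOn he hg (by omega)
        by_contra hne
        have huniv : {z | z ∈ e} = Set.univ := by
          refine hconn _ ⟨v, hve⟩ ?_
          intro k hk a hak b hbk hae
          rcases Sym2.eq_or_eq_or_eq_of_mem (show a ∈ e from hae) hve hwg with h | h | h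
          · subst h
            exact eq_of_edgeDeg_eq_one h1 hk hak he hae ▸ hbk
          · subst h
            exact eq_of_edgeDeg_eq_one h2 hk hak he hae ▸ hbk
          · exact absurd h hne
        have hxe : x ∈ e := (Set.ext_iff.1 huniv x).2 trivial
        rcases Sym2.eq_or_eq_or_eq_of_mem hve hwg hxe with h | h | h
        · exact hne h
        · exact hvx h
        · exact hwx h
      · exact absurd hvw (hleafmid v w hvx hwx h1 (by omega))
      · exact absurd hvw.symm (hleafmid w v hwx hvx h2 (by omega))
      · exact hmidinj v w hvx hwx (by omega) (by omega) hvw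
  · have hxsum : ∑ e ∈ E.filter (fun e => x ∈ e), (F ∘ pos) e = 1 + F (E.card - 1) := by
      obtain ⟨g, hg, hxg, hge⟩ := exists_edge_ne_of_two_le_edgeDeg (hall x).ge e₀
      have hpair : E.filter (fun e => x ∈ e) = {e₀, g} := by
        symm
        refine Finset.eq_of_subset_of_card_le ?_ ?_
        · intro k hk
          simp only [Finset.mem_insert, Finset.mem_singleton] at hk
          rcases hk with rfl | rfl
          · exact Finset.mem_filter.2 ⟨he₀, hxe₀⟩
          · exact Finset.mem_filter.2 ⟨hg, hxg⟩
        · rw [Finset.card_pair hge.symm]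
          exact (hall x).le
      have hp : pos g + 1 = E.card := by
        refine (hxpos g hg hxg).resolve_left (fun h => hge ?_)
        exact hpos.injOn hg he₀ (h.trans hpos0.symm)
      rw [hpair, Finset.sum_pair hge.symm, Function.comp_apply, Function.comp_apply, hpos0, hF0,
        ← hp]
      rfl
    have hxother : ∀ y, y ≠ x → ∑ e ∈ E.filter (fun e => y ∈ e), (F ∘ pos) e ≠
        ∑ e ∈ E.filter (fun e => x ∈ e), (F ∘ pos) e := by
      intro y hyx h
      obtain ⟨i, hi, -, hs⟩ := hmid y hyx (hall y)
      have := hFne i hi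
      rw [hall x] at this
      omega
    by_cases hvx : v = x <;> by_cases hwx : w = x
    · rw [hvx, hwx]
    · exact absurd (hvx ▸ hvw.symm) (hxother w hwx)
    · exact absurd (hwx ▸ hvw) (hxother v hvx)
    · exact hmidinj v w hvx hwx (hall v) (hall w) hvw

end MaxDegreeTwo

theorem edgeDeg_edgeFS {V : Type*} [Fintype V] (G : SimpleGraph V) (v : V) :
    edgeDeg (edgeFS G) v = G.degree v := by
  rw [← G.card_incidenceFinset_eq_degree, G.incidenceFinset_eq_filter]
  unfold edgeDeg edgeFS SimpleGraph.edgeFinset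
  congr 1

theorem mem_edgeFS {V : Type*} [Fintype V] (G : SimpleGraph V) (e : Sym2 V) :
    e ∈ edgeFS G ↔ e ∈ G.edgeSet := by
  simp [edgeFS]

theorem SimpleGraph.Connected.eq_univ_of_edge_closed {V : Type*} [Fintype V]
    {G : SimpleGraph V} (hG : G.Connected) (X : Set V) (hX : X.Nonempty)
    (hcl : ∀ e ∈ edgeFS G, ∀ x ∈ e, ∀ y ∈ e, x ∈ X → y ∈ X) : X = Set.univ := by
  obtain ⟨a, ha⟩ := hX
  refine Set.eq_univ_of_forall (fun b => ?_)
  obtain ⟨p⟩ := hG.preconnected a b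
  induction p with
  | nil => exact ha
  | @cons u v w h _ ih =>
    exact ih (hcl s(u, v) ((mem_edgeFS G _).2 h) u (Sym2.mem_mk_left u v) v
      (Sym2.mem_mk_right u v) ha)

/-- Every connected graph with `m ≥ 3` edges in which every vertex of
degree at least three is a support vertex is antimagic: there is a bijection from the
edges to `{1, …, m}` with pairwise distinct induced vertex sums. -/
theorem stmt_2 {V : Type*} [Fintype V] (G : SimpleGraph V) (m : ℕ) (hm : 3 ≤ m)
    (hcard : (edgeFS G).card = m) (hconn : G.Connected)
    (hsupp : ∀ v : V, 3 ≤ G.degree v → ∃ u : V, G.Adj v u ∧ G.degree u = 1) :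
    ∃ φ : Sym2 V → ℕ,
      Set.BijOn φ ↑(edgeFS G) ↑(Finset.Icc 1 m) ∧
      Function.Injective (fun v : V => ∑ e ∈ (edgeFS G).filter (fun e => v ∈ e), φ e) := by
  subst hcard
  have hdiag : ∀ e ∈ edgeFS G, ¬ e.IsDiag := fun e he =>
    G.not_isDiag_of_mem_edgeSet ((mem_edgeFS G e).1 he)
  have hclosed := hconn.eq_univ_of_edge_closed
  have hdeg : ∀ v, 1 ≤ edgeDeg (edgeFS G) v := by
    intro v
    by_contra! h0
    have hno : ∀ e ∈ edgeFS G, v ∉ e := by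
      have h := Finset.card_eq_zero.1 (show ((edgeFS G).filter (v ∈ ·)).card = 0 from
        Nat.lt_one_iff.1 h0)
      exact fun e he hve => Finset.notMem_empty e (h ▸ Finset.mem_filter.2 ⟨he, hve⟩)
    have huniv := hclosed {v} ⟨v, rfl⟩ (by
      rintro e he x hx y hy rfl
      exact absurd hx (hno e he))
    obtain ⟨e, he⟩ := Finset.card_pos.1 (show 0 < (edgeFS G).card by omega)
    induction e with
    | _ a b =>
      have ha : a = v := (Set.ext_iff.1 huniv a).2 trivial
      exact hno _ he (ha ▸ Sym2.mem_mk_left a b)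
  by_cases hbig : ∃ v, 3 ≤ edgeDeg (edgeFS G) v
  · have hE : IsBranchedEdgeSet (edgeFS G) := ⟨hdiag, hdeg, hclosed, hbig⟩
    have hsupp' : ∀ v, ∃ u, 3 ≤ edgeDeg (edgeFS G) v → G.Adj v u ∧ G.degree u = 1 := by
      intro v
      by_cases hv : 3 ≤ edgeDeg (edgeFS G) v
      · rw [edgeDeg_edgeFS] at hv
        obtain ⟨u, hu⟩ := hsupp v hv
        exact ⟨u, fun _ => hu⟩
      · exact ⟨v, fun h => absurd h hv⟩
    choose l hl using hsupp'
    refine hE.exists_antimagic (f := fun v => s(v, l v)) (fun v hv => ?_)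
    exact ⟨(mem_edgeFS G _).2 (hl v hv).1, Sym2.mem_mk_left _ _, l v, Sym2.mem_mk_right _ _,
      (edgeDeg_edgeFS G _).trans (hl v hv).2⟩
  · push Not at hbig
    exact exists_antimagic_of_edgeDeg_le_two hdiag
      (fun v => ⟨hdeg v, Nat.lt_succ_iff.1 (hbig v)⟩) hclosed hm
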